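/- Let f ∈ C_0(ℝ^d), F(γ) := e^{⟨f,γ⟩}, and ε > 0. Then ∫_Γ (H_ε^+ F)(γ)² μ(dγ) = ∫_{ℝ^d} z dx ∫_{ℝ^d} dy_1 ∫_{ℝ^d} dy_2 (e^{f(x)}−1)(e^{f(x + (y_2−y_1)/ε)}−1) a(y_1) a(y_2) ∫_Γ exp[(2s−1)E(x − y_1/ε, γ) + (s−1)E(x,γ) + (s−1)E(x + (y_2−y_1)/ε, γ) + ⟨2f,γ⟩] μ(dγ) + ∫_{ℝ^d} z dx_1 ∫_{ℝ^d} z dx_2 ∫_{ℝ^d} dy_1 ∫_{ℝ^d} dy_2 e^{f(x_1/ε + y_1)} e^{f(x_2/ε + y_2)} (e^{f(y_1)}−1)(e^{f(y_2)}−1) a(x_1) a(x_2) exp[(2s−1)φ((x_1−x_2)/ε + y_1 − y_2) + (s−1)φ(x_1/ε + y_1 − y_2) + (s−1)φ(y_1 − y_2 − x_2/ε)] ∫_Γ exp[(s−1)E(y_1,γ) + (s−1)E(y_2,γ) + (s−1)E(x_1/ε + y_1, γ) + (s−1)E(x_2/ε + y_2, γ) + ⟨2f,γ⟩] μ(dγ).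 -/

import Mathlib

open MeasureTheory Set Filter
open scoped ENNReal NNReal BigOperators Topology Classical

noncomputable section

abbrev EucSp (d : ℕ) := EuclideanSpace ℝ (Fin d)

/-- The configuration space `Γ` over `ℝ^d`: locally finite subsets. -/
def Config (d : ℕ) : Type :=
  {γ : Set (EucSp d) // ∀ Λ : Set (EucSp d), IsCompact Λ → (γ ∩ Λ).Finite}

/-- The σ-algebra on `Γ` generated by the maps `γ ↦ |γ ∩ B|`, `B` Borel. -/
instance Config.instMS (d : ℕ) : MeasurableSpace (Config d) :=
  ⨆ (B : Set (EucSp d)) (_ : MeasurableSet B),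
    MeasurableSpace.comap (fun γ : Config d => (γ.1 ∩ B).encard) (⊤ : MeasurableSpace ℕ∞)

/-- `γ ∪ {x}`. -/
def Config.ins {d : ℕ} (γ : Config d) (x : EucSp d) : Config d :=
  ⟨insert x γ.1, fun Λ hΛ => ((γ.2 Λ hΛ).insert x).subset fun y hy => by
    rcases hy with ⟨h1, h2⟩
    rcases h1 with rfl | h1
    · exact Set.mem_insert _ _
    · exact Set.mem_insert_of_mem _ ⟨h1, h2⟩⟩

/-- `γ ∖ {x}`. -/
def Config.del {d : ℕ} (γ : Config d) (x : EucSp d) : Config d :=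
  ⟨γ.1 \ {x}, fun Λ hΛ => (γ.2 Λ hΛ).subset fun y hy => ⟨hy.1.1, hy.2⟩⟩

/-- The pairing `⟨f, γ⟩ = ∑_{x ∈ γ} f x`. -/
def cpair {d : ℕ} (f : EucSp d → ℝ) (γ : Config d) : ℝ := ∑' x : γ.1, f x.1

/-- `exp : [-∞,∞] → [0,∞]`. -/
def eexp (x : EReal) : ℝ≥0∞ :=
  if x = ⊤ then ⊤ else if x = ⊥ then 0 else ENNReal.ofReal (Real.exp x.toReal)

/-- real-valued exponential of an extended real (with `exp(±∞)` sent to junk value `0`). -/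
def rexp (x : EReal) : ℝ := (eexp x).toReal

/-- The relative energy `E(x,γ) = ∑_{y ∈ γ} φ(x-y)` if absolutely convergent, `+∞` otherwise. -/
def energy {d : ℕ} (φ : EucSp d → EReal) (x : EucSp d) (γ : Set (EucSp d)) : EReal :=
  if (∀ y ∈ γ, φ (x - y) ≠ ⊤) ∧ Summable (fun y : γ => (φ (x - y.1)).toReal)
  then (((∑' y : γ, (φ (x - y.1)).toReal) : ℝ) : EReal)
  else ⊤

/-- `∑_{u ∈ γ} φ(u)` if absolutely convergent, `+∞` otherwise. -/
def totPhi {d : ℕ} (φ : EucSp d → EReal) (γ : Set (EucSp d)) : EReal :=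
  if (∀ y ∈ γ, φ y ≠ ⊤) ∧ Summable (fun y : γ => (φ y.1).toReal)
  then (((∑' y : γ, (φ y.1).toReal) : ℝ) : EReal)
  else ⊤

/-- A pair potential: Borel, even, with `φ(x) ∈ ℝ` off the origin. -/
structure IsPairPotential {d : ℕ} (φ : EucSp d → EReal) : Prop where
  meas : Measurable φ
  even : ∀ x : EucSp d, x ≠ 0 → φ (-x) = φ x
  finite_off : ∀ x : EucSp d, x ≠ 0 → φ x ≠ ⊤
  ne_bot : ∀ x, φ x ≠ ⊥

/-- Stability (S): `∑_{{x,y} ⊆ η} φ(x-y) ≥ -B|η|` for all finite `η`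
(stated with the sum over ordered pairs, which doubles both sides). -/
def Stable {d : ℕ} (φ : EucSp d → EReal) (B : ℝ) : Prop :=
  ∀ η : Finset (EucSp d),
    ((-(2 * B * η.card) : ℝ) : EReal) ≤ ∑ p ∈ η.offDiag, φ (p.1 - p.2)

/-- Low activity–high temperature (LA-HT): `∫ |e^{-φ} - 1| z dx < (2 e^{1+2B})⁻¹`. -/
def LAHT {d : ℕ} (φ : EucSp d → EReal) (z B : ℝ) : Prop :=
  ∫⁻ x : EucSp d, ENNReal.ofReal (|rexp (-(φ x)) - 1| * z)
    < ENNReal.ofReal (2 * Real.exp (1 + 2 * B))⁻¹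

/-- The Georgii–Nguyen–Zessin identity characterizing `μ ∈ G(z,φ)`. -/
def GNZ {d : ℕ} (z : ℝ) (φ : EucSp d → EReal) (μ : Measure (Config d)) : Prop :=
  ∀ F : Config d → EucSp d → ℝ≥0∞,
    Measurable (Function.uncurry F) →
    ∫⁻ γ, ∑' x : γ.1, F γ x.1 ∂μ
      = ∫⁻ γ, ∫⁻ x, ENNReal.ofReal z * eexp (-(energy φ x γ.1)) * F (γ.ins x) x ∂volume ∂μ


/-- Ordered `n`-tuples of distinct points of `γ`. -/
def injTuples {d : ℕ} (n : ℕ) (γ : Set (EucSp d)) : Set (Fin n → EucSp d) :=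
  {p | Function.Injective p ∧ ∀ i, p i ∈ γ}

/-- `(k_μ^{(n)})` is the family of correlation functions of `μ`: each `k n` is measurable,
nonnegative and symmetric, and for every measurable symmetric `f : (ℝ^d)^n → [0,∞]`,
`∫_Γ ∑_{{x_1,…,x_n} ⊆ γ} f dμ = (1/n!) ∫ f·kₙ dx` (stated equivalently via the sum over
ordered tuples of distinct points, which absorbs the factor `1/n!`). -/
def HasCorrFns {d : ℕ} (μ : Measure (Config d)) (k : ∀ n : ℕ, (Fin n → EucSp d) → ℝ) : Prop :=
  (∀ n : ℕ, Measurable (k n) ∧ (∀ x, 0 ≤ k n x) ∧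
      ∀ (σ : Equiv.Perm (Fin n)) (x : Fin n → EucSp d), k n (x ∘ σ) = k n x) ∧
  ∀ n : ℕ, 0 < n → ∀ f : (Fin n → EucSp d) → ℝ≥0∞, Measurable f →
    (∀ (σ : Equiv.Perm (Fin n)) (x : Fin n → EucSp d), f (x ∘ σ) = f x) →
    ∫⁻ γ, ∑' p : injTuples n γ.1, f p.1 ∂μ
      = ∫⁻ x : Fin n → EucSp d, f x * ENNReal.ofReal (k n x)

/-- The Ruelle bound `k^{(n)} ≤ ξⁿ`. -/
def RuelleBound {d : ℕ} (k : ∀ n : ℕ, (Fin n → EucSp d) → ℝ) (ξ : ℝ) : Prop :=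
  ∀ n : ℕ, 0 < n → ∀ x : Fin n → EucSp d, k n x ≤ ξ ^ n

/-- Translation invariance of a family of functions on tuples. -/
def TransInvFns {d : ℕ} (k : ∀ n : ℕ, (Fin n → EucSp d) → ℝ) : Prop :=
  ∀ (n : ℕ) (a : EucSp d) (x : Fin n → EucSp d), k n (fun i => x i + a) = k n x

/-- `P` is a partition of `{0,…,n-1}` into nonempty pairwise disjoint blocks. -/
def IsPartOfUniv {n : ℕ} (P : Finset (Finset (Fin n))) : Prop :=
  (∀ b ∈ P, b.Nonempty) ∧ (P : Set (Finset (Fin n))).PairwiseDisjoint id ∧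
    P.sup id = Finset.univ

/-- `u` is the family of Ursell functions of `k`:
`k(η) = ∑ u(η_1) ⋯ u(η_j)`, summing over all partitions of `η`. -/
def IsUrsell {d : ℕ} (k u : ∀ n : ℕ, (Fin n → EucSp d) → ℝ) : Prop :=
  ∀ n : ℕ, 0 < n → ∀ x : Fin n → EucSp d,
    k n x = ∑ P : Finset (Finset (Fin n)),
      if IsPartOfUniv P then ∏ b ∈ P, u b.card (fun i => x (b.orderIsoOfFin rfl i).1) else 0

/-- `f ∈ C_0(ℝ^d)`: continuous with compact support. -/
def IsC0 {d : ℕ} (f : EucSp d → ℝ) : Prop := Continuous f ∧ HasCompactSupport f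

/-- Cylinder functions `FC_b(C_0(ℝ^d),Γ)`. -/
def Cyl {d : ℕ} (F : Config d → ℝ) : Prop :=
  ∃ (N : ℕ) (f : Fin N → EucSp d → ℝ) (g : (Fin N → ℝ) → ℝ),
    (∀ i, IsC0 (f i)) ∧ Continuous g ∧ (∃ C, ∀ y, |g y| ≤ C) ∧
    ∀ γ, F γ = g fun i => cpair (f i) γ

/-- `(D_x^- F)(γ) = F(γ∖x) - F(γ)`. -/
def Dminus {d : ℕ} (F : Config d → ℝ) (x : EucSp d) (γ : Config d) : ℝ := F (γ.del x) - F γ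

/-- `(D_x^+ F)(γ) = F(γ∪x) - F(γ)`. -/
def Dplus {d : ℕ} (F : Config d → ℝ) (x : EucSp d) (γ : Config d) : ℝ := F (γ.ins x) - F γ

/-- `(D_{xy}^{-+} F)(γ) = F(γ∖x∪y) - F(γ)`. -/
def Dpm {d : ℕ} (F : Config d → ℝ) (x y : EucSp d) (γ : Config d) : ℝ :=
  F ((γ.del x).ins y) - F γ

/-- The Glauber bilinear form `E_G`. -/
def glauberForm {d : ℕ} (s : ℝ) (φ : EucSp d → EReal) (μ : Measure (Config d))
    (F G : Config d → ℝ) : ℝ :=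
  ∫ γ, (∑' x : γ.1,
      rexp ((s : EReal) * energy φ x.1 (γ.1 \ {x.1})) * Dminus F x.1 γ * Dminus G x.1 γ) ∂μ

/-- The Kawasaki bilinear form `E_K`. -/
def kawasakiForm {d : ℕ} (s : ℝ) (a : EucSp d → ℝ) (φ : EucSp d → EReal)
    (μ : Measure (Config d)) (F G : Config d → ℝ) : ℝ :=
  (1 / 2) * ∫ γ, (∑' x : γ.1, ∫ y : EucSp d,
      a (x.1 - y) *
        rexp ((s : EReal) * energy φ x.1 (γ.1 \ {x.1}) +
          ((s - 1 : ℝ) : EReal) * energy φ y (γ.1 \ {x.1})) *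
        Dpm F x.1 y γ * Dpm G x.1 y γ) ∂μ

/-- The Glauber generator `H_G`. -/
def HG {d : ℕ} (s z : ℝ) (φ : EucSp d → EReal) (F : Config d → ℝ) (γ : Config d) : ℝ :=
  -(∑' x : γ.1, rexp ((s : EReal) * energy φ x.1 (γ.1 \ {x.1})) * Dminus F x.1 γ)
    - ∫ x : EucSp d, z * rexp (((s - 1 : ℝ) : EReal) * energy φ x γ.1) * Dplus F x γ

/-- The Kawasaki generator `H_K`. -/
def HK {d : ℕ} (s : ℝ) (a : EucSp d → ℝ) (φ : EucSp d → EReal) (F : Config d → ℝ)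
    (γ : Config d) : ℝ :=
  -(∑' x : γ.1, ∫ y : EucSp d,
      a (x.1 - y) * rexp ((s : EReal) * energy φ x.1 (γ.1 \ {x.1}) +
        ((s - 1 : ℝ) : EReal) * energy φ y (γ.1 \ {x.1})) * Dpm F x.1 y γ)

/-- The scaled jump kernel `a_ε(x) = ε^d a(ε x)`. -/
def aScaled {d : ℕ} (a : EucSp d → ℝ) (ε : ℝ) (x : EucSp d) : ℝ := ε ^ d * a (ε • x)

/-- `H_ε^-` (death part of the Kawasaki generator with kernel `aa`). -/
def HepsMinus {d : ℕ} (s : ℝ) (aa : EucSp d → ℝ) (φ : EucSp d → EReal)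
    (F : Config d → ℝ) (γ : Config d) : ℝ :=
  -(∑' x : γ.1, Dminus F x.1 γ * ∫ y : EucSp d,
      aa (x.1 - y) * rexp ((s : EReal) * energy φ x.1 (γ.1 \ {x.1}) +
        ((s - 1 : ℝ) : EReal) * energy φ y (γ.1 \ {x.1})))

/-- `H_ε^+` (birth part of the Kawasaki generator with kernel `aa`). -/
def HepsPlus {d : ℕ} (s : ℝ) (aa : EucSp d → ℝ) (φ : EucSp d → EReal)
    (F : Config d → ℝ) (γ : Config d) : ℝ :=
  -(∑' x : γ.1, ∫ y : EucSp d,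
      aa (x.1 - y) * rexp ((s : EReal) * energy φ x.1 (γ.1 \ {x.1}) +
        ((s - 1 : ℝ) : EReal) * energy φ y (γ.1 \ {x.1})) * Dplus F y (γ.del x.1))

/-- `H_0^-` (death part of the Glauber generator). -/
def H0Minus {d : ℕ} (s : ℝ) (φ : EucSp d → EReal) (F : Config d → ℝ) (γ : Config d) : ℝ :=
  -(∑' x : γ.1, rexp ((s : EReal) * energy φ x.1 (γ.1 \ {x.1})) * Dminus F x.1 γ)

/-- `H_0^+` (birth part of the Glauber generator). -/
def H0Plus {d : ℕ} (s z : ℝ) (φ : EucSp d → EReal) (F : Config d → ℝ) (γ : Config d) : ℝ :=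
  -∫ x : EucSp d, z * rexp (((s - 1 : ℝ) : EReal) * energy φ x γ.1) * Dplus F x γ

/-- The standing assumptions of the paper: `s ∈ [0,1/2]`, a stable pair potential in the
low activity–high temperature regime, bounded outside a ball, and `μ` the Gibbs measure
from Ruelle's theorem with its correlation and Ursell functions. -/
structure Setting (d : ℕ) (s z B ξ : ℝ) (φ : EucSp d → EReal) (μ : Measure (Config d))
    (k u : ∀ n : ℕ, (Fin n → EucSp d) → ℝ) : Prop where
  hd : 0 < d
  hs0 : 0 ≤ s
  hs1 : s ≤ 1 / 2
  pp : IsPairPotential φ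
  hB : 0 ≤ B
  stable : Stable φ B
  hz : 0 < z
  laht : LAHT φ z B
  bddOutside : ∃ R C : ℝ, ∀ x : EucSp d, R ≤ ‖x‖ → ∃ r : ℝ, φ x = (r : EReal) ∧ |r| ≤ C
  prob : IsProbabilityMeasure μ
  gnz : GNZ z φ μ
  corr : HasCorrFns μ k
  ti : TransInvFns k
  hξ : 0 < ξ
  ruelle : RuelleBound k ξ
  ursell : IsUrsell k u
  ursellInt : ∀ m : ℕ,
    Integrable (fun y : Fin (m + 1) → EucSp d => u (m + 2) (Fin.cons 0 y)) volume

/-- The jump kernel `a`: bounded, nonnegative, even, integrable. -/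
structure GoodA {d : ℕ} (a : EucSp d → ℝ) : Prop where
  meas : Measurable a
  nonneg : ∀ x, 0 ≤ a x
  bdd : ∃ C, ∀ x, a x ≤ C
  even : ∀ x, a (-x) = a x
  int : Integrable a volume

/-- `φ(x) → 0` as `|x| → ∞`. -/
def PhiVanishes {d : ℕ} (φ : EucSp d → EReal) : Prop :=
  Tendsto φ (cocompact (EucSp d)) (nhds (0 : EReal))

/-- The normalization `∫ a dx = (∫_Γ exp[(s-1) ∑_{u∈γ} φ(u)] dμ(γ))⁻¹`. -/
def NormalizedA {d : ℕ} (s : ℝ) (a : EucSp d → ℝ) (φ : EucSp d → EReal)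
    (μ : Measure (Config d)) : Prop :=
  (∫ x : EucSp d, a x) = (∫ γ, rexp (((s - 1 : ℝ) : EReal) * totPhi φ γ.1) ∂μ)⁻¹


/-! ### The counting kernel of configurations -/

section Counting

open ProbabilityTheory

theorem Config.countable {d : ℕ} (γ : Config d) : γ.1.Countable := by
  have h : γ.1 = ⋃ n : ℕ, γ.1 ∩ Metric.closedBall 0 n := by
    rw [← inter_iUnion, Metric.iUnion_closedBall_nat, inter_univ]
  rw [h]
  exact countable_iUnion fun n => (γ.2 _ (isCompact_closedBall 0 _)).countable

theorem Config.measurableSet {d : ℕ} (γ : Config d) : MeasurableSet γ.1 :=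
  γ.countable.measurableSet

/-- The counting measure `∑_{y ∈ γ} δ_y`. -/
def Config.counting {d : ℕ} (γ : Config d) : Measure (EucSp d) := Measure.count.restrict γ.1

theorem Config.counting_apply {d : ℕ} (γ : Config d) {B : Set (EucSp d)} (hB : MeasurableSet B) :
    γ.counting B = (γ.1 ∩ B).encard := by
  rw [Config.counting, Measure.restrict_apply hB, inter_comm,
    Measure.count_apply (γ.measurableSet.inter hB)]

theorem Config.lintegral_counting {d : ℕ} (γ : Config d) (h : EucSp d → ℝ≥0∞) :
    ∫⁻ y, h y ∂γ.counting = ∑' y : γ.1, h y.1 := by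
  simp [Config.counting, lintegral_countable _ γ.countable]

theorem Config.integrable_counting {d : ℕ} (γ : Config d) (h : EucSp d → ℝ) :
    Integrable h γ.counting ↔ Summable fun y : γ.1 => h y.1 := by
  have : Countable γ.1 := γ.countable.to_subtype
  have hm : AEStronglyMeasurable h γ.counting := by
    rw [Config.counting, ← map_comap_subtype_coe γ.measurableSet]
    exact ((MeasurableEmbedding.subtype_coe γ.measurableSet).aestronglyMeasurable_map_iff).2
      (Measurable.of_discrete).aestronglyMeasurable
  rw [Integrable, and_iff_right hm, HasFiniteIntegral, γ.lintegral_counting,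
    ← summable_norm_iff, ← tsum_enorm_ne_top_iff_summable_norm, lt_top_iff_ne_top]

theorem Config.integral_counting {d : ℕ} (γ : Config d) (h : EucSp d → ℝ) :
    ∫ y, h y ∂γ.counting = ∑' y : γ.1, h y.1 := by
  by_cases hi : Integrable h γ.counting
  · rw [Config.counting, setIntegral_countable _ γ.countable hi]
    simp [Measure.real]
  · rw [integral_undef hi, tsum_eq_zero_of_not_summable (mt (γ.integrable_counting h).2 hi)]

theorem Config.measurable_counting_apply {d : ℕ} {B : Set (EucSp d)} (hB : MeasurableSet B) :
    Measurable fun γ : Config d => γ.counting B := by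
  simp_rw [fun γ : Config d => γ.counting_apply hB]
  have h1 : @Measurable (Config d) ℕ∞ _ ⊤ fun γ : Config d => (γ.1 ∩ B).encard := by
    refine Measurable.of_comap_le ?_
    exact le_iSup₂_of_le B hB le_rfl
  exact (@measurable_from_top _ _ _ (fun n : ℕ∞ => (n : ℝ≥0∞))).comp h1

theorem isSFiniteKernel_of_isFiniteMeasure {α β : Type*} [MeasurableSpace α] [MeasurableSpace β]
    (κ : Kernel α β) (h : ∀ a, IsFiniteMeasure (κ a)) : IsSFiniteKernel κ := by
  have hm : Measurable fun a => ⌈(κ a univ).toReal⌉₊ :=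
    Nat.measurable_ceil.comp (κ.measurable_coe MeasurableSet.univ).ennreal_toReal
  have hs (k : ℕ) : MeasurableSet {a | ⌈(κ a univ).toReal⌉₊ = k} := hm (measurableSet_singleton k)
  refine ⟨fun k => Kernel.piecewise (hs k) κ 0,
    fun k => ⟨k, ENNReal.natCast_lt_top k, fun a => ?_⟩, ?_⟩
  · rw [Kernel.piecewise_apply]
    split_ifs with ha
    · rw [← ENNReal.ofReal_toReal (measure_ne_top (κ a) univ), ← ENNReal.ofReal_natCast]
      exact ENNReal.ofReal_le_ofReal ((Nat.le_ceil _).trans_eq (by exact_mod_cast ha))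
    · simp
  · ext a B hB
    rw [Kernel.sum_apply' _ _ hB, tsum_eq_single ⌈(κ a univ).toReal⌉₊]
    · simp [Kernel.piecewise_apply]
    · intro k hk
      simp [Kernel.piecewise_apply, hk.symm]

/-- The counting measures as a kernel. -/
def countingKernel (d : ℕ) : Kernel (Config d) (EucSp d) where
  toFun γ := γ.counting
  measurable' := Measure.measurable_of_measurable_coe _ fun _ hB =>
    Config.measurable_counting_apply hB

@[simp]
theorem countingKernel_apply {d : ℕ} (γ : Config d) : countingKernel d γ = γ.counting := rfl

instance {d : ℕ} : IsSFiniteKernel (countingKernel d) := by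
  have hA (n : ℕ) : MeasurableSet (disjointed (fun n : ℕ => Metric.closedBall (0 : EucSp d) n) n) :=
    MeasurableSet.disjointed (fun n => Metric.isClosed_closedBall.measurableSet) n
  have h1 (n : ℕ) : IsSFiniteKernel ((countingKernel d).restrict (hA n)) := by
    refine isSFiniteKernel_of_isFiniteMeasure _ fun γ => ⟨?_⟩
    rw [Kernel.restrict_apply, Measure.restrict_apply_univ, countingKernel_apply]
    refine (measure_mono (disjointed_subset _ n)).trans_lt ?_
    rw [γ.counting_apply Metric.isClosed_closedBall.measurableSet]
    simpa using (γ.2 _ (isCompact_closedBall 0 _))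
  have h2 : countingKernel d = Kernel.sum fun n => (countingKernel d).restrict (hA n) := by
    ext γ B hB
    rw [Kernel.sum_apply, ← Measure.restrict_univ (μ := countingKernel d γ),
      ← Metric.iUnion_closedBall_nat (0 : EucSp d), ← iUnion_disjointed,
      Measure.restrict_iUnion (disjoint_disjointed _) hA]
    simp [Kernel.restrict_apply]
  rw [h2]
  exact Kernel.isSFiniteKernel_sum (hκs := h1)

theorem measurable_tsum_config {d : ℕ} {Ω : Type*} [MeasurableSpace Ω] {g : Ω → Config d}
    (hg : Measurable g) {h : Ω → EucSp d → ℝ≥0∞} (hh : Measurable (Function.uncurry h)) :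
    Measurable fun ω => ∑' y : (g ω).1, h ω y.1 := by
  simp_rw [← Config.lintegral_counting]
  exact hh.lintegral_kernel_prod_right (κ := (countingKernel d).comap g hg)

theorem Config.measurable_of_counting {d : ℕ} {Ω : Type*} [MeasurableSpace Ω] {g : Ω → Config d}
    (h : ∀ B, MeasurableSet B → Measurable fun ω => (g ω).counting B) : Measurable g := by
  rw [measurable_iff_comap_le]
  simp only [Config.instMS, MeasurableSpace.comap_iSup, MeasurableSpace.comap_comp, iSup_le_iff]
  intro B hB
  refine measurable_iff_comap_le.1 ?_
  have h1 := h B hB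
  simp_rw [Config.counting_apply _ hB] at h1
  refine @measurable_to_countable' _ _ ⊤ _ _ _ fun n => ?_
  have : (fun ω => ((g ω).1 ∩ B).encard) ⁻¹' {n}
      = (fun ω => (((g ω).1 ∩ B).encard : ℝ≥0∞)) ⁻¹' {(n : ℝ≥0∞)} := by
    ext ω; simp
  exact this ▸ h1 (measurableSet_singleton _)

theorem Config.counting_del {d : ℕ} (γ : Config d) (x : EucSp d) {B : Set (EucSp d)}
    (hB : MeasurableSet B) : (γ.del x).counting B = γ.counting (B \ {x}) := by
  rw [Config.counting_apply _ hB, Config.counting_apply _ (hB.diff (measurableSet_singleton x))]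
  congr 2
  ext y
  simp [Config.del]
  tauto

theorem Config.counting_ins {d : ℕ} (γ : Config d) (x : EucSp d) {B : Set (EucSp d)}
    (hB : MeasurableSet B) :
    (γ.ins x).counting B = B.indicator 1 x + γ.counting (B \ {x}) := by
  rw [Config.counting_apply _ hB, Config.counting_apply _ (hB.diff (measurableSet_singleton x))]
  by_cases hx : x ∈ B
  · have : (γ.ins x).1 ∩ B = insert x (γ.1 ∩ (B \ {x})) := by
      ext y
      by_cases hy : y = x <;> simp [Config.ins, hy, hx]
    rw [this, encard_insert_of_notMem (by simp)]
    simp [hx, add_comm]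
  · have : (γ.ins x).1 ∩ B = γ.1 ∩ (B \ {x}) := by
      ext y
      by_cases hy : y = x <;> simp [Config.ins, hy, hx]
    simp [this, hx]

theorem measurable_counting_diff {d : ℕ} {Ω : Type*} [MeasurableSpace Ω] {g : Ω → Config d}
    {x : Ω → EucSp d} (hg : Measurable g) (hx : Measurable x) {B : Set (EucSp d)}
    (hB : MeasurableSet B) : Measurable fun ω => (g ω).counting (B \ {x ω}) := by
  have h (ω : Ω) : (g ω).counting (B \ {x ω})
      = ∑' y : (g ω).1, ({p : Ω × EucSp d | p.2 ∈ B ∧ p.2 ≠ x p.1}.indicator 1 (ω, y.1) : ℝ≥0∞) := by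
    rw [← Config.lintegral_counting _ fun y =>
      ({p : Ω × EucSp d | p.2 ∈ B ∧ p.2 ≠ x p.1}.indicator 1 (ω, y) : ℝ≥0∞),
      ← lintegral_indicator_one (hB.diff (measurableSet_singleton _))]
    rfl
  simp_rw [h]
  refine measurable_tsum_config hg (h := fun ω y =>
    ({p : Ω × EucSp d | p.2 ∈ B ∧ p.2 ≠ x p.1}.indicator 1 (ω, y) : ℝ≥0∞))
    (measurable_one.indicator ?_)
  exact (measurable_snd hB).inter
    (measurableSet_eq_fun measurable_snd (hx.comp measurable_fst)).compl

@[fun_prop]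
theorem Measurable.config_del {d : ℕ} {Ω : Type*} [MeasurableSpace Ω] {g : Ω → Config d}
    {x : Ω → EucSp d} (hg : Measurable g) (hx : Measurable x) :
    Measurable fun ω => (g ω).del (x ω) :=
  Config.measurable_of_counting fun B hB => by
    simpa only [Config.counting_del _ _ hB] using measurable_counting_diff hg hx hB

@[fun_prop]
theorem Measurable.config_ins {d : ℕ} {Ω : Type*} [MeasurableSpace Ω] {g : Ω → Config d}
    {x : Ω → EucSp d} (hg : Measurable g) (hx : Measurable x) :
    Measurable fun ω => (g ω).ins (x ω) :=
  Config.measurable_of_counting fun B hB => by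
    simp only [Config.counting_ins _ _ hB]
    exact ((measurable_one.indicator hB).comp hx).add (measurable_counting_diff hg hx hB)

theorem measurable_tsum_config_real {d : ℕ} {Ω : Type*} [MeasurableSpace Ω] {g : Ω → Config d}
    (hg : Measurable g) {h : Ω → EucSp d → ℝ} (hh : Measurable (Function.uncurry h)) :
    Measurable fun ω => ∑' y : (g ω).1, h ω y.1 := by
  simp_rw [← Config.integral_counting]
  exact (hh.stronglyMeasurable.integral_kernel_prod_right
    (κ := (countingKernel d).comap g hg)).measurable

theorem measurableSet_summable_config {d : ℕ} {Ω : Type*} [MeasurableSpace Ω] {g : Ω → Config d}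
    (hg : Measurable g) {h : Ω → EucSp d → ℝ} (hh : Measurable (Function.uncurry h)) :
    MeasurableSet {ω | Summable fun y : (g ω).1 => h ω y.1} := by
  have (ω : Ω) : Summable (fun y : (g ω).1 => h ω y.1) ↔ ∑' y : (g ω).1, ‖h ω y.1‖ₑ ≠ ⊤ := by
    rw [tsum_enorm_ne_top_iff_summable_norm, summable_norm_iff]
  simp_rw [this]
  exact (measurable_tsum_config hg (h := fun ω y => ‖h ω y‖ₑ) hh.enorm)
    (measurableSet_singleton _).compl

theorem measurableSet_forall_mem_config {d : ℕ} {Ω : Type*} [MeasurableSpace Ω] {g : Ω → Config d}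
    (hg : Measurable g) {p : Ω → EucSp d → Prop}
    (hp : MeasurableSet {q : Ω × EucSp d | p q.1 q.2}) :
    MeasurableSet {ω | ∀ y ∈ (g ω).1, p ω y} := by
  have (ω : Ω) : (∀ y ∈ (g ω).1, p ω y) ↔
      ∑' y : (g ω).1, ({q : Ω × EucSp d | p q.1 q.2}ᶜ.indicator 1 (ω, y.1) : ℝ≥0∞) = 0 := by
    simp [ENNReal.tsum_eq_zero, indicator_apply]
  simp_rw [this]
  exact measurable_tsum_config hg (h := fun ω y =>
    ({q : Ω × EucSp d | p q.1 q.2}ᶜ.indicator 1 (ω, y) : ℝ≥0∞)) (measurable_one.indicator hp.compl)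
    (measurableSet_singleton _)

theorem measurable_energy {d : ℕ} {φ : EucSp d → EReal} (hφ : Measurable φ) {Ω : Type*}
    [MeasurableSpace Ω] {g : Ω → Config d} {x : Ω → EucSp d} (hg : Measurable g)
    (hx : Measurable x) : Measurable fun ω => energy φ (x ω) (g ω).1 := by
  have h1 : Measurable fun q : Ω × EucSp d => φ (x q.1 - q.2) := by fun_prop
  unfold energy
  refine Measurable.ite ?_ ?_ measurable_const
  · exact (measurableSet_forall_mem_config hg (p := fun ω y => φ (x ω - y) ≠ ⊤)
      (h1 (measurableSet_singleton ⊤).compl)).inter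
      (measurableSet_summable_config hg (h := fun ω y => (φ (x ω - y)).toReal)
        h1.ereal_toReal)
  · exact (measurable_tsum_config_real hg (h := fun ω y => (φ (x ω - y)).toReal)
      h1.ereal_toReal).coe_real_ereal

theorem measurable_cpair {d : ℕ} {f : EucSp d → ℝ} (hf : Measurable f) {Ω : Type*}
    [MeasurableSpace Ω] {g : Ω → Config d} (hg : Measurable g) :
    Measurable fun ω => cpair f (g ω) :=
  measurable_tsum_config_real hg (h := fun _ y => f y) (by fun_prop)

theorem measurable_eexp : Measurable eexp := by
  unfold eexp
  refine Measurable.ite (measurableSet_singleton _) measurable_const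
    (Measurable.ite (measurableSet_singleton _) measurable_const ?_)
  exact (Real.measurable_exp.comp measurable_ereal_toReal).ennreal_ofReal

theorem measurable_rexp : Measurable rexp := measurable_eexp.ennreal_toReal

@[simp]
theorem eexp_coe (r : ℝ) : eexp r = ENNReal.ofReal (Real.exp r) := by simp [eexp]

@[simp]
theorem rexp_coe (r : ℝ) : rexp r = Real.exp r := by simp [rexp, Real.exp_nonneg]

theorem rexp_nonneg (x : EReal) : 0 ≤ rexp x := ENNReal.toReal_nonneg

end Counting

/-! ### Exponential moments from the Ruelle bound -/

theorem prod_one_add_le_tsum_injTuples {d : ℕ} (γ : Set (EucSp d)) (A : Finset (EucSp d))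
    (hA : (A : Set (EucSp d)) ⊆ γ) (ψ : EucSp d → ℝ≥0∞) :
    ∏ y ∈ A, (1 + ψ y)
      ≤ ∑' n : ℕ, (n.factorial : ℝ≥0∞)⁻¹ * ∑' p : injTuples n γ, ∏ i, ψ (p.1 i) := by
  rw [Finset.prod_one_add, Finset.sum_powerset]
  refine le_trans (Finset.sum_le_sum fun n _ => ?_) (ENNReal.sum_le_tsum _)
  rw [← ENNReal.div_eq_inv_mul, ENNReal.le_div_iff_mul_le (by simp [n.factorial_ne_zero]) (by simp)]
  let Φ : (Σ t : Finset.powersetCard n A, Fin n ≃ t.1) → injTuples n γ := fun q =>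
    ⟨fun i => (q.2 i).1, fun i j hij => q.2.injective (Subtype.ext hij),
      fun i => hA ((Finset.mem_powersetCard.1 q.1.2).1 (q.2 i).2)⟩
  have hΦ : Function.Injective Φ := by
    rintro ⟨⟨t, ht⟩, e⟩ ⟨⟨t', ht'⟩, e'⟩ h
    have h1 (i : Fin n) : (e i).1 = (e' i).1 := congrFun (congrArg Subtype.val h) i
    have h2 : t = t' := by
      ext y
      constructor
      · intro hy
        obtain ⟨i, hi⟩ := e.surjective ⟨y, hy⟩
        have := h1 i
        rw [hi] at this
        rw [show y = (e' i).1 from this]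
        exact (e' i).2
      · intro hy
        obtain ⟨i, hi⟩ := e'.surjective ⟨y, hy⟩
        have := h1 i
        rw [hi] at this
        rw [show y = (e i).1 from this.symm]
        exact (e i).2
    subst h2
    obtain rfl : e = e' := Equiv.ext fun i => Subtype.ext (h1 i)
    rfl
  refine le_trans (le_of_eq ?_) (ENNReal.tsum_comp_le_tsum_of_injective hΦ _)
  rw [ENNReal.tsum_sigma', tsum_fintype, Finset.sum_mul,
    ← Finset.sum_coe_sort (Finset.powersetCard n A)]
  refine Finset.sum_congr rfl fun t _ => ?_
  have h3 (e : Fin n ≃ t.1) : ∏ i, ψ ((Φ ⟨t, e⟩).1 i) = ∏ y ∈ t.1, ψ y := by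
    rw [← Finset.prod_coe_sort t.1 ψ]
    exact Fintype.prod_equiv e _ _ fun i => rfl
  have ht : t.1.card = n := (Finset.mem_powersetCard.1 t.2).2
  rw [tsum_fintype, Finset.sum_congr rfl fun e _ => h3 e, Finset.sum_const, Finset.card_univ,
    Fintype.card_equiv (t.1.equivFinOfCardEq ht).symm, Fintype.card_fin, nsmul_eq_mul, mul_comm]

/-- Tuples of `n + 1` distinct points: a first point and `n` distinct points among the others. -/
def injTuplesSuccEquiv {d : ℕ} (n : ℕ) (γ : Config d) :
    injTuples (n + 1) γ.1 ≃ Σ y : γ.1, injTuples n (γ.del y.1).1 where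
  toFun p := ⟨⟨p.1 0, p.2.2 0⟩, ⟨fun i => p.1 i.succ,
    fun _ _ hij => Fin.succ_injective _ (p.2.1 hij),
    fun i => ⟨p.2.2 _, fun h => Fin.succ_ne_zero i (p.2.1 h)⟩⟩⟩
  invFun q := ⟨Fin.cons q.1.1 q.2.1, Fin.cons_injective_iff.2
    ⟨fun ⟨i, hi⟩ => (q.2.2.2 i).2 hi, q.2.2.1⟩,
    fun i => Fin.cases q.1.2 (fun j => (q.2.2.2 j).1) i⟩
  left_inv p := Subtype.ext (Fin.cons_self_tail p.1)
  right_inv _ := rfl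

theorem tsum_injTuples_succ {d : ℕ} (n : ℕ) (γ : Config d) (ψ : EucSp d → ℝ≥0∞) :
    ∑' p : injTuples (n + 1) γ.1, ∏ i, ψ (p.1 i)
      = ∑' y : γ.1, ψ y.1 * ∑' p : injTuples n (γ.del y.1).1, ∏ i, ψ (p.1 i) := by
  rw [← (injTuplesSuccEquiv n γ).symm.tsum_eq, ENNReal.tsum_sigma']
  refine tsum_congr fun y => ?_
  rw [← ENNReal.tsum_mul_left]
  refine tsum_congr fun p => ?_
  rw [Fin.prod_univ_succ]
  rfl

theorem tsum_injTuples_zero {d : ℕ} (γ : Set (EucSp d)) (ψ : EucSp d → ℝ≥0∞) :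
    ∑' p : injTuples 0 γ, ∏ i, ψ (p.1 i) = 1 := by
  have : Unique (injTuples 0 γ) :=
    ⟨⟨⟨Fin.elim0, fun i => i.elim0, fun i => i.elim0⟩⟩,
      fun _ => Subtype.ext (Subsingleton.elim _ _)⟩
  simp_rw [Fin.prod_univ_zero]
  rw [tsum_eq_single default fun p hp => (hp (Subsingleton.elim p _)).elim]

theorem measurable_tsum_injTuples {d : ℕ} (n : ℕ) {ψ : EucSp d → ℝ≥0∞} (hψ : Measurable ψ) :
    Measurable fun γ : Config d => ∑' p : injTuples n γ.1, ∏ i, ψ (p.1 i) := by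
  induction n with
  | zero =>
    simp_rw [tsum_injTuples_zero]
    exact measurable_const
  | succ n ih =>
    simp_rw [tsum_injTuples_succ]
    refine measurable_tsum_config measurable_id (h := fun γ y => ψ y *
      ∑' p : injTuples n (γ.del y).1, ∏ i, ψ (p.1 i)) ?_
    exact (hψ.comp measurable_snd).mul
      (ih.comp (measurable_fst.config_del measurable_snd))

/-- The exponential series in `[0,∞]`. -/
def expSeries (t : ℝ≥0∞) : ℝ≥0∞ := ∑' n : ℕ, (n.factorial : ℝ≥0∞)⁻¹ * t ^ n

theorem expSeries_ne_top {t : ℝ≥0∞} (ht : t ≠ ⊤) : expSeries t ≠ ⊤ := by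
  lift t to ℝ≥0 using ht
  have h : Summable fun n : ℕ => (n.factorial : ℝ≥0)⁻¹ * t ^ n := by
    rw [← NNReal.summable_coe]
    simpa [div_eq_inv_mul] using Real.summable_pow_div_factorial (t : ℝ)
  convert ENNReal.tsum_coe_ne_top_iff_summable.2 h using 3 with n
  unfold expSeries
  refine tsum_congr fun n => ?_
  push_cast
  rw [ENNReal.coe_inv (by exact_mod_cast n.factorial_ne_zero)]
  simp

theorem lintegral_fin_prod {d : ℕ} (n : ℕ) {ψ : EucSp d → ℝ≥0∞} (hψ : Measurable ψ) :
    ∫⁻ x : Fin n → EucSp d, ∏ i, ψ (x i) = (∫⁻ x, ψ x) ^ n := by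
  induction n with
  | zero => simp [volume_pi]
  | succ n ih =>
    rw [← (volume_preserving_piFinSuccAbove (fun _ : Fin (n + 1) => EucSp d) 0).symm.lintegral_comp
      (by fun_prop)]
    simp_rw [Fin.prod_univ_succ]
    simp only [MeasurableEquiv.piFinSuccAbove_symm_apply, Fin.insertNthEquiv_apply,
      Fin.insertNth_zero, Fin.cons_zero, Fin.cons_succ, cast_eq]
    rw [pow_succ', ← ih]
    exact lintegral_prod_mul hψ.aemeasurable (g := fun x : Fin n → EucSp d => ∏ i, ψ (x i))
      (Finset.measurable_prod _ fun i _ => hψ.comp (measurable_pi_apply i)).aemeasurable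

theorem lintegral_tsum_injTuples_le {d : ℕ} {μ : Measure (Config d)} [IsProbabilityMeasure μ]
    {k : ∀ n : ℕ, (Fin n → EucSp d) → ℝ} {ξ : ℝ} (hξ : 0 ≤ ξ) (hk : HasCorrFns μ k)
    (hR : RuelleBound k ξ) (n : ℕ) {ψ : EucSp d → ℝ≥0∞} (hψ : Measurable ψ) :
    ∫⁻ γ, ∑' p : injTuples n γ.1, ∏ i, ψ (p.1 i) ∂μ ≤ (ENNReal.ofReal ξ * ∫⁻ x, ψ x) ^ n := by
  rcases Nat.eq_zero_or_pos n with rfl | hn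
  · simp_rw [tsum_injTuples_zero]
    simp
  · rw [hk.2 n hn (fun p => ∏ i, ψ (p i)) (by fun_prop)
      (fun σ x => Fintype.prod_equiv σ _ _ fun i => rfl)]
    calc _ ≤ ∫⁻ x : Fin n → EucSp d, (∏ i, ψ (x i)) * ENNReal.ofReal ξ ^ n := by
          refine lintegral_mono fun x => ?_
          rw [← ENNReal.ofReal_pow hξ]
          gcongr
          exact hR n hn x
      _ = _ := by
          rw [lintegral_mul_const _ (by fun_prop), mul_pow, mul_comm, lintegral_fin_prod n hψ]


theorem exp_le_one_add_mul {t M : ℝ} (h0 : 0 ≤ t) (hM : t ≤ M) :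
    Real.exp t ≤ 1 + Real.exp M * t := by
  have h1 : Real.exp t * (1 - t) ≤ 1 := by
    calc _ ≤ Real.exp t * Real.exp (-t) := by
          gcongr
          linarith [Real.add_one_le_exp (-t)]
      _ = 1 := by rw [← Real.exp_add]; simp
  have h2 : Real.exp t * t ≤ Real.exp M * t := by gcongr
  linarith

theorem lintegral_exp_tsum_le {d : ℕ} {μ : Measure (Config d)} [IsProbabilityMeasure μ]
    {k : ∀ n : ℕ, (Fin n → EucSp d) → ℝ} {ξ : ℝ} (hξ : 0 ≤ ξ) (hk : HasCorrFns μ k)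
    (hR : RuelleBound k ξ) {ψ : EucSp d → ℝ} (hψ : Measurable ψ) {M : ℝ} (h0 : ∀ x, 0 ≤ ψ x)
    (hM : ∀ x, ψ x ≤ M) :
    ∫⁻ γ, ENNReal.ofReal (Real.exp (∑' y : γ.1, ψ y.1)) ∂μ
      ≤ expSeries (ENNReal.ofReal ξ * ∫⁻ x, ENNReal.ofReal (Real.exp M * ψ x)) := by
  have hψ' : Measurable fun x => ENNReal.ofReal (Real.exp M * ψ x) := by fun_prop
  have hpt (γ : Config d) : ENNReal.ofReal (Real.exp (∑' y : γ.1, ψ y.1))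
      ≤ ∑' n : ℕ, (n.factorial : ℝ≥0∞)⁻¹ *
        ∑' p : injTuples n γ.1, ∏ i, ENNReal.ofReal (Real.exp M * ψ (p.1 i)) := by
    by_cases hs : Summable fun y : γ.1 => ψ y.1
    · refine le_of_tendsto (((ENNReal.continuous_ofReal.comp Real.continuous_exp).tendsto _).comp
        hs.hasSum) (Eventually.of_forall fun A => ?_)
      have h1 := prod_one_add_le_tsum_injTuples γ.1 (A.map (Function.Embedding.subtype _))
        (by simp) (fun x => ENNReal.ofReal (Real.exp M * ψ x))
      refine le_trans ?_ h1
      rw [Finset.prod_map, Function.comp_apply, Function.comp_apply, Real.exp_sum,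
        ENNReal.ofReal_prod_of_nonneg fun _ _ => Real.exp_nonneg _]
      refine Finset.prod_le_prod' fun y _ => ?_
      rw [← ENNReal.ofReal_one, ← ENNReal.ofReal_add zero_le_one
        (mul_nonneg (Real.exp_nonneg _) (h0 _))]
      exact ENNReal.ofReal_le_ofReal (exp_le_one_add_mul (h0 _) (hM _))
    · rw [tsum_eq_zero_of_not_summable hs]
      refine le_trans (le_of_eq ?_) (ENNReal.le_tsum 0)
      rw [tsum_injTuples_zero γ.1 fun x => ENNReal.ofReal (Real.exp M * ψ x)]
      simp
  refine (lintegral_mono hpt).trans ?_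
  rw [lintegral_tsum fun n => ((measurable_tsum_injTuples n hψ').const_mul _).aemeasurable]
  refine ENNReal.tsum_le_tsum fun n => ?_
  rw [lintegral_const_mul _ (measurable_tsum_injTuples n hψ')]
  gcongr
  exact lintegral_tsum_injTuples_le hξ hk hR n hψ'

theorem lintegral_tsum_le {d : ℕ} {μ : Measure (Config d)} [IsProbabilityMeasure μ]
    {k : ∀ n : ℕ, (Fin n → EucSp d) → ℝ} {ξ : ℝ} (hξ : 0 ≤ ξ) (hk : HasCorrFns μ k)
    (hR : RuelleBound k ξ) {ψ : EucSp d → ℝ≥0∞} (hψ : Measurable ψ) :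
    ∫⁻ γ, ∑' y : γ.1, ψ y.1 ∂μ ≤ ENNReal.ofReal ξ * ∫⁻ x, ψ x := by
  have h := lintegral_tsum_injTuples_le hξ hk hR 1 hψ
  simpa only [tsum_injTuples_succ, tsum_injTuples_zero, mul_one, pow_one] using h

/-! ### The Georgii–Nguyen–Zessin identity for real functions, to first and second order -/

theorem nullSingletonClass_volume {d : ℕ} (hd : 0 < d) :
    NullSingletonClass (volume : Measure (EucSp d)) := by
  have : Nonempty (Fin d) := ⟨⟨0, hd⟩⟩
  infer_instance

theorem Config.ae_notMem {d : ℕ} [NullSingletonClass (volume : Measure (EucSp d))] (γ : Config d) :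
    ∀ᵐ x, x ∉ γ.1 :=
  measure_eq_zero_iff_ae_notMem.1 (γ.countable.measure_zero _)

theorem Config.del_ins {d : ℕ} {γ : Config d} {x : EucSp d} (hx : x ∉ γ.1) :
    (γ.ins x).del x = γ := by
  refine Subtype.ext ?_
  ext y
  by_cases hy : y = x <;> simp [Config.ins, Config.del, hy, hx]

theorem Config.ins_del {d : ℕ} {γ : Config d} {x : EucSp d} (hx : x ∈ γ.1) :
    (γ.del x).ins x = γ := by
  refine Subtype.ext ?_
  ext y
  by_cases hy : y = x <;> simp [Config.ins, Config.del, hy, hx]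

theorem Config.del_ins_comm {d : ℕ} {γ : Config d} {x y : EucSp d} (hx : x ∈ γ.1) (hxy : x ≠ y) :
    ((γ.del x).del y).ins x = γ.del y := by
  refine Subtype.ext ?_
  ext w
  by_cases hw : w = x
  · subst hw; simp [Config.ins, Config.del, hx, hxy]
  · simp [Config.ins, Config.del, hw]

theorem energy_ne_bot {d : ℕ} (φ : EucSp d → EReal) (x : EucSp d) (γ : Set (EucSp d)) :
    energy φ x γ ≠ ⊥ := by
  unfold energy
  split_ifs <;> simp

/-- The Papangelou intensity `z e^{-E(x,γ)}`. -/
def papangelou {d : ℕ} (z : ℝ) (φ : EucSp d → EReal) (γ : Config d) (x : EucSp d) : ℝ :=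
  z * rexp (-(energy φ x γ.1))

theorem papangelou_nonneg {d : ℕ} {z : ℝ} (hz : 0 ≤ z) (φ : EucSp d → EReal) (γ : Config d)
    (x : EucSp d) : 0 ≤ papangelou z φ γ x :=
  mul_nonneg hz (rexp_nonneg _)

theorem ofReal_papangelou {d : ℕ} {z : ℝ} (hz : 0 ≤ z) (φ : EucSp d → EReal) (γ : Config d)
    (x : EucSp d) : ENNReal.ofReal (papangelou z φ γ x)
      = ENNReal.ofReal z * eexp (-(energy φ x γ.1)) := by
  have h : eexp (-(energy φ x γ.1)) ≠ ⊤ := by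
    unfold eexp
    split_ifs with h1 h2
    · simp [energy_ne_bot] at h1
    · simp
    · simp
  rw [papangelou, ENNReal.ofReal_mul hz, rexp, ENNReal.ofReal_toReal h]

theorem measurable_papangelou {d : ℕ} {z : ℝ} {φ : EucSp d → EReal} (hφ : Measurable φ)
    {Ω : Type*} [MeasurableSpace Ω] {g : Ω → Config d} {x : Ω → EucSp d} (hg : Measurable g)
    (hx : Measurable x) : Measurable fun ω => papangelou z φ (g ω) (x ω) :=
  (measurable_rexp.comp (measurable_energy hφ hg hx).neg).const_mul z

theorem measurable_del_fst {d : ℕ} :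
    Measurable fun p : Config d × EucSp d => (p.1.del p.2, p.2) :=
  (measurable_fst.config_del measurable_snd).prodMk measurable_snd

section Mecke

open ProbabilityTheory

variable {d : ℕ} {z : ℝ} {φ : EucSp d → EReal} {μ : Measure (Config d)}

theorem map_compProd_countingKernel [NullSingletonClass (volume : Measure (EucSp d))] [SFinite μ]
    (hz : 0 ≤ z) (hφ : Measurable φ) (hμ : GNZ z φ μ) :
    (μ ⊗ₘ countingKernel d).map (fun p => (p.1.del p.2, p.2))
      = (μ.prod volume).withDensity fun p => ENNReal.ofReal (papangelou z φ p.1 p.2) := by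
  have hd : Measurable fun p : Config d × EucSp d => ENNReal.ofReal (papangelou z φ p.1 p.2) :=
    (measurable_papangelou hφ measurable_fst measurable_snd).ennreal_ofReal
  ext A hA
  have h1 : Measurable (A.indicator (1 : Config d × EucSp d → ℝ≥0∞)) := measurable_one.indicator hA
  rw [Measure.map_apply measurable_del_fst hA, withDensity_apply _ hA, ← lintegral_indicator hA,
    Measure.compProd_apply (measurable_del_fst hA), lintegral_prod _ (hd.indicator hA).aemeasurable]
  calc _ = ∫⁻ γ, ∑' x : γ.1, A.indicator 1 (γ.del x.1, x.1) ∂μ := by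
        refine lintegral_congr fun γ => ?_
        rw [← Config.lintegral_counting _ fun x => (A.indicator 1 (γ.del x, x) : ℝ≥0∞),
          countingKernel_apply, ← lintegral_indicator_one (by
            exact (measurable_del_fst.comp measurable_prodMk_left) hA)]
        rfl
    _ = _ := hμ (fun γ x => A.indicator 1 (γ.del x, x)) (h1.comp measurable_del_fst)
    _ = _ := by
        refine lintegral_congr fun γ => lintegral_congr_ae ?_
        filter_upwards [γ.ae_notMem] with x hx
        rw [Config.del_ins hx, ← ofReal_papangelou hz]
        by_cases hA' : (γ, x) ∈ A <;> simp [hA']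

variable [NullSingletonClass (volume : Measure (EucSp d))] [SFinite μ]

theorem lintegral_tsum_del (hz : 0 ≤ z) (hφ : Measurable φ) (hμ : GNZ z φ μ)
    {h : Config d × EucSp d → ℝ≥0∞} (hh : Measurable h) :
    ∫⁻ γ, ∑' x : γ.1, h (γ.del x.1, x.1) ∂μ
      = ∫⁻ p, ENNReal.ofReal (papangelou z φ p.1 p.2) * h p ∂(μ.prod volume) := by
  have hd : Measurable fun p : Config d × EucSp d => ENNReal.ofReal (papangelou z φ p.1 p.2) :=
    (measurable_papangelou hφ measurable_fst measurable_snd).ennreal_ofReal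
  calc _ = ∫⁻ p, h (p.1.del p.2, p.2) ∂(μ ⊗ₘ countingKernel d) := by
        rw [Measure.lintegral_compProd (f := fun p : Config d × EucSp d => h (p.1.del p.2, p.2))
          (hh.comp measurable_del_fst)]
        simp_rw [countingKernel_apply, Config.lintegral_counting]
    _ = ∫⁻ p, h p ∂((μ ⊗ₘ countingKernel d).map (fun p => (p.1.del p.2, p.2))) :=
        (lintegral_map hh measurable_del_fst).symm
    _ = _ := by
        rw [map_compProd_countingKernel hz hφ hμ, lintegral_withDensity_eq_lintegral_mul _ hd hh]
        rfl

theorem integral_tsum_del (hz : 0 ≤ z) (hφ : Measurable φ) (hμ : GNZ z φ μ)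
    {H : Config d × EucSp d → ℝ}
    (hi : Integrable (fun p => papangelou z φ p.1 p.2 * H p) (μ.prod volume)) :
    (∀ᵐ γ ∂μ, Summable fun x : γ.1 => H (γ.del x.1, x.1)) ∧
      ∫ γ, ∑' x : γ.1, H (γ.del x.1, x.1) ∂μ
        = ∫ p, papangelou z φ p.1 p.2 * H p ∂(μ.prod volume) := by
  have hd : Measurable fun p : Config d × EucSp d => ENNReal.ofReal (papangelou z φ p.1 p.2) :=
    (measurable_papangelou hφ measurable_fst measurable_snd).ennreal_ofReal
  have h0 (p : Config d × EucSp d) : 0 ≤ papangelou z φ p.1 p.2 := papangelou_nonneg hz _ _ _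
  have h1 : Integrable H ((μ ⊗ₘ countingKernel d).map (fun p => (p.1.del p.2, p.2))) := by
    rw [map_compProd_countingKernel hz hφ hμ,
      integrable_withDensity_iff_integrable_smul' hd (by simp)]
    simpa [h0] using hi
  have h2 : Integrable (fun p : Config d × EucSp d => H (p.1.del p.2, p.2))
      (μ ⊗ₘ countingKernel d) := h1.comp_measurable measurable_del_fst
  constructor
  · have h3 := ((Measure.integrable_compProd_iff h2.aestronglyMeasurable).1 h2).1
    filter_upwards [h3] with γ hγ
    exact (γ.integrable_counting fun x => H (γ.del x, x)).1 hγ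
  · calc _ = ∫ p, H (p.1.del p.2, p.2) ∂(μ ⊗ₘ countingKernel d) := by
          rw [Measure.integral_compProd h2]
          simp_rw [countingKernel_apply, fun γ : Config d => γ.integral_counting fun x => H (γ.del x, x)]
      _ = ∫ p, H p ∂((μ ⊗ₘ countingKernel d).map (fun p => (p.1.del p.2, p.2))) :=
          (integral_map measurable_del_fst.aemeasurable h1.aestronglyMeasurable).symm
      _ = _ := by
          rw [map_compProd_countingKernel hz hφ hμ,
            integral_withDensity_eq_integral_toReal_smul hd (by simp)]
          simp [h0]

end Mecke

section SecondOrder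

variable {d : ℕ} {z : ℝ} {φ : EucSp d → EReal} {μ : Measure (Config d)}

theorem Config.tsum_eq_add_tsum_del {d : ℕ} {γ : Config d} {g : EucSp d → ℝ}
    (hg : Summable fun y : γ.1 => g y.1) {x : EucSp d} (hx : x ∈ γ.1) :
    ∑' y : γ.1, g y.1 = g x + ∑' y : (γ.del x).1, g y.1 := by
  have hg' : Summable (γ.1.indicator g) := summable_subtype_iff_indicator.1 hg
  rw [tsum_subtype γ.1 g, tsum_subtype (γ.del x).1 g, hg'.tsum_eq_add_tsum_ite x,
    indicator_of_mem hx]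
  congr 2
  ext y
  by_cases hy : y = x <;> simp [Config.del, indicator_apply, hy]

/-- The integrand of the off-diagonal term in the second-order Georgii–Nguyen–Zessin identity. -/
def offDiagMecke (z : ℝ) (φ : EucSp d → EReal) (G : Config d × EucSp d → ℝ)
    (q : (Config d × EucSp d) × EucSp d) : ℝ :=
  papangelou z φ (q.1.1.ins q.1.2) q.2 * G (q.1.1.ins q.1.2, q.2) * G (q.1.1.ins q.2, q.1.2)

theorem measurable_offDiagMecke (hφ : Measurable φ) {G : Config d × EucSp d → ℝ}
    (hG : Measurable G) : Measurable (offDiagMecke z φ G) := by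
  unfold offDiagMecke
  refine ((measurable_papangelou hφ ?_ measurable_snd).mul (hG.comp ?_)).mul (hG.comp ?_)
  all_goals fun_prop

theorem papangelou_mul_tsum (G : Config d × EucSp d → ℝ) (γ : Config d) (x : EucSp d) :
    papangelou z φ γ x * (G (γ, x) * ∑' y : γ.1, G ((γ.del y.1).ins x, y.1))
      = ∑' y : γ.1, offDiagMecke z φ G ((γ.del y.1, y.1), x) := by
  rw [← mul_assoc, ← tsum_mul_left]
  refine tsum_congr fun y => ?_
  simp only [offDiagMecke, Config.ins_del y.2]

variable [NullSingletonClass (volume : Measure (EucSp d))] [SFinite μ]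

theorem integral_papangelou_mul_tsum (hz : 0 ≤ z) (hφ : Measurable φ) (hμ : GNZ z φ μ)
    {G : Config d × EucSp d → ℝ} (hG : Measurable G)
    (h : Integrable (fun q : (Config d × EucSp d) × EucSp d =>
      papangelou z φ q.1.1 q.1.2 * offDiagMecke z φ G q) ((μ.prod volume).prod volume)) :
    Integrable (fun p : Config d × EucSp d => papangelou z φ p.1 p.2 *
        (G p * ∑' y : p.1.1, G ((p.1.del y.1).ins p.2, y.1))) (μ.prod volume) ∧
      ∫ p : Config d × EucSp d, papangelou z φ p.1 p.2 *
        (G p * ∑' y : p.1.1, G ((p.1.del y.1).ins p.2, y.1)) ∂(μ.prod volume)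
      = ∫ q : (Config d × EucSp d) × EucSp d,
          papangelou z φ q.1.1 q.1.2 * offDiagMecke z φ G q ∂((μ.prod volume).prod volume) := by
  have hQ := measurable_offDiagMecke (z := z) hφ hG
  have hm : Measurable fun p : Config d × EucSp d =>
      ∑' y : p.1.1, offDiagMecke z φ G ((p.1.del y.1, y.1), p.2) :=
    measurable_tsum_config_real measurable_fst
      (h := fun p y => offDiagMecke z φ G ((p.1.del y, y), p.2)) (hQ.comp (by fun_prop))
  have hQ' (x : EucSp d) : Measurable fun p => offDiagMecke z φ G (p, x) :=
    hQ.comp (by fun_prop)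
  have hi : Integrable (fun p : Config d × EucSp d =>
      ∑' y : p.1.1, offDiagMecke z φ G ((p.1.del y.1, y.1), p.2)) (μ.prod volume) := by
    refine ⟨hm.aestronglyMeasurable, ?_⟩
    calc ∫⁻ p : Config d × EucSp d,
          ‖∑' y : p.1.1, offDiagMecke z φ G ((p.1.del y.1, y.1), p.2)‖ₑ ∂(μ.prod volume)
        = ∫⁻ x, ∫⁻ γ, ‖∑' y : γ.1, offDiagMecke z φ G ((γ.del y.1, y.1), x)‖ₑ ∂μ :=
          lintegral_prod_symm _ hm.enorm.aemeasurable
      _ ≤ ∫⁻ x, ∫⁻ γ, ∑' y : γ.1, ‖offDiagMecke z φ G ((γ.del y.1, y.1), x)‖ₑ ∂μ := by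
          gcongr
          exact enorm_tsum_le_tsum_enorm
      _ = ∫⁻ x, ∫⁻ p, ‖papangelou z φ p.1 p.2 * offDiagMecke z φ G (p, x)‖ₑ ∂(μ.prod volume) := by
          refine lintegral_congr fun x => ?_
          rw [lintegral_tsum_del hz hφ hμ (h := fun p => ‖offDiagMecke z φ G (p, x)‖ₑ)
            (hQ' x).enorm]
          refine lintegral_congr fun p => ?_
          rw [enorm_mul, Real.enorm_eq_ofReal (papangelou_nonneg hz _ _ _)]
      _ = ∫⁻ q : (Config d × EucSp d) × EucSp d,
            ‖papangelou z φ q.1.1 q.1.2 * offDiagMecke z φ G q‖ₑ ∂((μ.prod volume).prod volume) :=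
          (lintegral_prod_symm _ h.aestronglyMeasurable.enorm).symm
      _ < ⊤ := h.2
  simp_rw [papangelou_mul_tsum]
  refine ⟨hi, ?_⟩
  rw [integral_prod_symm _ hi, integral_prod_symm _ h]
  refine integral_congr_ae ?_
  filter_upwards [h.prod_left_ae] with x hx
  exact (integral_tsum_del hz hφ hμ (H := fun p => offDiagMecke z φ G (p, x)) hx).2

theorem integral_sq_tsum_del (hz : 0 ≤ z) (hφ : Measurable φ) (hμ : GNZ z φ μ)
    {G : Config d × EucSp d → ℝ} (hG : Measurable G)
    (h1 : Integrable (fun p => papangelou z φ p.1 p.2 * G p) (μ.prod volume))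
    (h2 : Integrable (fun p => papangelou z φ p.1 p.2 * G p ^ 2) (μ.prod volume))
    (h3 : Integrable (fun q : (Config d × EucSp d) × EucSp d =>
      papangelou z φ q.1.1 q.1.2 * offDiagMecke z φ G q) ((μ.prod volume).prod volume)) :
    ∫ γ, (∑' x : γ.1, G (γ.del x.1, x.1)) ^ 2 ∂μ
      = ∫ p, papangelou z φ p.1 p.2 * G p ^ 2 ∂(μ.prod volume)
        + ∫ q : (Config d × EucSp d) × EucSp d,
          papangelou z φ q.1.1 q.1.2 * offDiagMecke z φ G q ∂((μ.prod volume).prod volume) := by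
  obtain ⟨h4, h5⟩ := integral_papangelou_mul_tsum hz hφ hμ hG h3
  set H : Config d × EucSp d → ℝ := fun p =>
    G p ^ 2 + G p * ∑' y : p.1.1, G ((p.1.del y.1).ins p.2, y.1)
  have hH : (fun p : Config d × EucSp d => papangelou z φ p.1 p.2 * H p)
      = fun p => papangelou z φ p.1 p.2 * G p ^ 2 + papangelou z φ p.1 p.2 *
        (G p * ∑' y : p.1.1, G ((p.1.del y.1).ins p.2, y.1)) := by
    ext p
    simp only [H]
    ring
  have h6 := (integral_tsum_del hz hφ hμ (H := H) (hH ▸ h2.add h4)).2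
  rw [hH, integral_add h2 h4, h5] at h6
  rw [← h6]
  refine integral_congr_ae ?_
  filter_upwards [(integral_tsum_del hz hφ hμ h1).1] with γ hγ
  rw [sq, ← tsum_mul_right]
  refine tsum_congr fun x => ?_
  simp only [H]
  rw [sq, ← mul_add, Config.tsum_eq_add_tsum_del (g := fun y => G (γ.del y, y)) hγ x.2]
  congr 2
  refine tsum_congr fun y => ?_
  rw [Config.del_ins_comm x.2 (fun h => y.2.2 h.symm)]

end SecondOrder

/-! ### Estimates for the relative energy -/

/-- The negative part of the potential, set to `0` at the origin. -/
def negPot {d : ℕ} (φ : EucSp d → EReal) (x : EucSp d) : ℝ :=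
  if x = 0 then 0 else max 0 (-(φ x).toReal)

section Estimates

variable {d : ℕ} {s z B ξ : ℝ} {φ : EucSp d → EReal} {μ : Measure (Config d)}
  {k u : ∀ n : ℕ, (Fin n → EucSp d) → ℝ}

theorem negPot_nonneg (φ : EucSp d → EReal) (x : EucSp d) : 0 ≤ negPot φ x := by
  unfold negPot
  split_ifs <;> simp

theorem measurable_negPot (hφ : Measurable φ) : Measurable (negPot φ) :=
  Measurable.ite (measurableSet_singleton 0) measurable_const
    (measurable_const.max hφ.ereal_toReal.neg)

theorem neg_toReal_le_negPot (φ : EucSp d → EReal) {x : EucSp d} (hx : x ≠ 0) :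
    -(φ x).toReal ≤ negPot φ x := by
  simp [negPot, hx]

theorem IsPairPotential.coe_toReal (h : IsPairPotential φ) {x : EucSp d} (hx : x ≠ 0) :
    ((φ x).toReal : EReal) = φ x :=
  EReal.coe_toReal (h.finite_off x hx) (h.ne_bot x)

theorem Stable.neg_le_toReal (hS : Stable φ B) (h : IsPairPotential φ) {x : EucSp d}
    (hx : x ≠ 0) : -(2 * B) ≤ (φ x).toReal := by
  have h1 := hS {0, x}
  have h2 : ({0, x} : Finset (EucSp d)).offDiag = {(0, x), (x, 0)} := by
    ext ⟨a, b⟩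
    simp only [Finset.mem_offDiag, Finset.mem_insert, Finset.mem_singleton, Prod.mk.injEq]
    constructor
    · rintro ⟨rfl | rfl, rfl | rfl, h⟩ <;> simp_all
    · rintro (⟨rfl, rfl⟩ | ⟨rfl, rfl⟩) <;> simp [hx, hx.symm]
  rw [h2, Finset.sum_pair (by simp [hx.symm]), Finset.card_pair hx.symm] at h1
  simp only [zero_sub, sub_zero, h.even x hx] at h1
  rw [← h.coe_toReal hx, ← EReal.coe_add, EReal.coe_le_coe_iff] at h1
  push_cast at h1
  linarith

theorem Stable.negPot_le (hS : Stable φ B) (hB : 0 ≤ B) (h : IsPairPotential φ) (x : EucSp d) :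
    negPot φ x ≤ 2 * B := by
  unfold negPot
  split_ifs with hx
  · linarith
  · exact max_le (by linarith) (by linarith [hS.neg_le_toReal h hx])

theorem IsPairPotential.rexp_neg (h : IsPairPotential φ) {x : EucSp d} (hx : x ≠ 0) :
    rexp (-(φ x)) = Real.exp (-(φ x).toReal) := by
  rw [← h.coe_toReal hx, ← EReal.coe_neg, rexp_coe, EReal.toReal_coe]

theorem IsPairPotential.negPot_le_abs (h : IsPairPotential φ) (x : EucSp d) :
    negPot φ x ≤ |rexp (-(φ x)) - 1| := by
  unfold negPot
  split_ifs with hx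
  · positivity
  · rw [h.rexp_neg hx]
    refine max_le (abs_nonneg _) ?_
    linarith [le_abs_self (Real.exp (-(φ x).toReal) - 1), Real.add_one_le_exp (-(φ x).toReal)]

theorem LAHT.lintegral_ne_top (h : LAHT φ z B) (hz : 0 < z) :
    ∫⁻ x, ENNReal.ofReal |rexp (-(φ x)) - 1| ≠ ⊤ := by
  have h1 := (h.trans ENNReal.ofReal_lt_top).ne
  simp_rw [ENNReal.ofReal_mul (abs_nonneg _)] at h1
  rw [lintegral_mul_const' _ _ ENNReal.ofReal_ne_top] at h1
  intro h2
  rw [h2, ENNReal.top_mul (by simpa using hz)] at h1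
  exact h1 rfl

theorem abs_le_exp_mul_abs_exp_neg_sub_one {t C : ℝ} (ht : |t| ≤ C) :
    |t| ≤ Real.exp C * |Real.exp (-t) - 1| := by
  have hC : 1 ≤ Real.exp C := Real.one_le_exp ((abs_nonneg t).trans ht)
  rcases le_total t 0 with h | h
  · rw [abs_of_nonpos h, abs_of_nonneg (by linarith [Real.add_one_le_exp (-t)])]
    nlinarith [Real.add_one_le_exp (-t)]
  · rw [abs_of_nonneg h] at ht ⊢
    have h1 : Real.exp (-t) ≤ 1 := Real.exp_le_one_iff.2 (by linarith)
    rw [abs_of_nonpos (by linarith)]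
    have h2 : Real.exp t * (1 - Real.exp (-t)) = Real.exp t - 1 := by
      rw [mul_sub, ← Real.exp_add]; simp
    have h3 : Real.exp t * (1 - Real.exp (-t)) ≤ Real.exp C * (1 - Real.exp (-t)) := by
      gcongr
    linarith [Real.add_one_le_exp t]

theorem Setting.nullSingletonClass (hset : Setting d s z B ξ φ μ k u) :
    NullSingletonClass (volume : Measure (EucSp d)) :=
  nullSingletonClass_volume hset.hd

theorem Setting.ae_notMem (hset : Setting d s z B ξ φ μ k u) (x : EucSp d) :
    ∀ᵐ γ ∂μ, x ∉ γ.1 := by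
  have := hset.prob
  have := hset.nullSingletonClass
  have h1 : Measurable (({x} : Set (EucSp d)).indicator (1 : EucSp d → ℝ≥0∞)) :=
    measurable_one.indicator (measurableSet_singleton x)
  have h2 := lintegral_tsum_le hset.hξ.le hset.corr hset.ruelle h1
  rw [lintegral_indicator_one (measurableSet_singleton x), measure_singleton, mul_zero,
    nonpos_iff_eq_zero, lintegral_eq_zero_iff
      (measurable_tsum_config measurable_id' (h := fun _ y => ({x} : Set (EucSp d)).indicator 1 y)
        (h1.comp measurable_snd))] at h2
  filter_upwards [h2] with γ hγ hx
  rw [Pi.zero_apply, ENNReal.tsum_eq_zero] at hγ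
  simpa using hγ ⟨x, hx⟩

theorem energy_eq_coe {x : EucSp d} {γ : Set (EucSp d)} (h : energy φ x γ ≠ ⊤) :
    energy φ x γ = ((∑' y : γ, (φ (x - y.1)).toReal : ℝ) : EReal) ∧
      (∀ y ∈ γ, φ (x - y) ≠ ⊤) ∧ Summable fun y : γ => (φ (x - y.1)).toReal := by
  unfold energy at h ⊢
  split_ifs at h ⊢ with h1
  · exact ⟨rfl, h1⟩
  · exact absurd rfl h

theorem Setting.ae_energy_ne_top (hset : Setting d s z B ξ φ μ k u) (x : EucSp d) :
    ∀ᵐ γ ∂μ, energy φ x γ.1 ≠ ⊤ := by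
  have := hset.prob
  obtain ⟨R, C, hRC⟩ := hset.bddOutside
  set R' := max R 1
  have hR' : 0 < R' := lt_max_of_lt_right one_pos
  set ψ : EucSp d → ℝ≥0∞ := (Metric.ball 0 R')ᶜ.indicator fun y => ‖(φ y).toReal‖ₑ
  have hψm : Measurable ψ := by
    refine Measurable.indicator ?_ Metric.isOpen_ball.measurableSet.compl
    exact hset.pp.meas.ereal_toReal.enorm
  have hψ (y : EucSp d) :
      ψ y ≤ ENNReal.ofReal (Real.exp C) * ENNReal.ofReal |rexp (-(φ y)) - 1| := by
    by_cases hy : y ∈ (Metric.ball 0 R')ᶜ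
    · have hy' : R' ≤ ‖y‖ := by simpa using hy
      have hy0 : y ≠ 0 := norm_pos_iff.1 (hR'.trans_le hy')
      obtain ⟨r, hr, hrC⟩ := hRC y ((le_max_left _ _).trans hy')
      simp only [ψ, indicator_of_mem hy]
      rw [hset.pp.rexp_neg hy0, hr, EReal.toReal_coe, ← ENNReal.ofReal_mul (Real.exp_nonneg _),
        ← ofReal_norm, Real.norm_eq_abs]
      exact ENNReal.ofReal_le_ofReal (abs_le_exp_mul_abs_exp_neg_sub_one hrC)
    · simp [ψ, indicator_of_notMem hy]
  have h1 : ∫⁻ γ : Config d, ∑' y : γ.1, ψ (x - y.1) ∂μ < ⊤ := by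
    refine (lintegral_tsum_le hset.hξ.le hset.corr hset.ruelle
      (ψ := fun y => ψ (x - y)) (by fun_prop)).trans_lt ?_
    rw [lintegral_sub_left_eq_self]
    refine ENNReal.mul_lt_top ENNReal.ofReal_lt_top ((lintegral_mono hψ).trans_lt ?_)
    rw [lintegral_const_mul' _ _ ENNReal.ofReal_ne_top]
    exact ENNReal.mul_lt_top ENNReal.ofReal_lt_top (hset.laht.lintegral_ne_top hset.hz).lt_top
  have h2 := ae_lt_top (measurable_tsum_config measurable_id' (h := fun _ y => ψ (x - y))
    (by fun_prop)) h1.ne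
  filter_upwards [h2, hset.ae_notMem x] with γ hγ hx
  have hne (y : EucSp d) (hy : y ∈ γ.1) : x - y ≠ 0 := by
    rw [sub_ne_zero]
    rintro rfl
    exact hx hy
  have hfin : {y : γ.1 | x - y.1 ∈ Metric.ball 0 R'}.Finite := by
    refine Set.Finite.of_finite_image (f := Subtype.val) ?_ Subtype.val_injective.injOn
    refine (γ.2 _ (isCompact_closedBall x R')).subset ?_
    rintro _ ⟨y, hy, rfl⟩
    refine ⟨y.2, ?_⟩
    have : ‖x - y.1‖ < R' := by simpa using hy
    rw [Metric.mem_closedBall, dist_comm, dist_eq_norm]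
    exact this.le
  have hsum : Summable fun y : γ.1 => (φ (x - y.1)).toReal := by
    rw [← hfin.summable_compl_iff, ← summable_norm_iff, ← tsum_enorm_ne_top_iff_summable_norm]
    refine ((ENNReal.tsum_le_tsum fun y => ?_).trans_lt ((ENNReal.tsum_comp_le_tsum_of_injective
      Subtype.val_injective fun y : γ.1 => ψ (x - y.1)).trans_lt hγ)).ne
    simp only [ψ]
    rw [indicator_of_mem (show x - y.1.1 ∈ (Metric.ball 0 R')ᶜ from y.2)]
    exact le_rfl
  unfold energy
  rw [if_pos ⟨fun y hy => hset.pp.finite_off _ (hne y hy), hsum⟩]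
  exact EReal.coe_ne_top _

/-- `x` is not a point of `γ` and has finite relative energy with respect to `γ`. -/
def FiniteEnergy (φ : EucSp d → EReal) (x : EucSp d) (γ : Config d) : Prop :=
  x ∉ γ.1 ∧ energy φ x γ.1 ≠ ⊤

theorem Setting.ae_finiteEnergy (hset : Setting d s z B ξ φ μ k u) (x : EucSp d) :
    ∀ᵐ γ ∂μ, FiniteEnergy φ x γ :=
  (hset.ae_notMem x).and (hset.ae_energy_ne_top x)

theorem FiniteEnergy.coe_toReal {x : EucSp d} {γ : Config d} (h : FiniteEnergy φ x γ) :
    ((energy φ x γ.1).toReal : EReal) = energy φ x γ.1 :=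
  EReal.coe_toReal h.2 (energy_ne_bot _ _ _)

theorem FiniteEnergy.hasSum {x : EucSp d} {γ : Config d} (h : FiniteEnergy φ x γ) :
    HasSum (fun y : γ.1 => (φ (x - y.1)).toReal) (energy φ x γ.1).toReal := by
  obtain ⟨h1, -, h3⟩ := energy_eq_coe h.2
  rw [h1, EReal.toReal_coe]
  exact h3.hasSum

theorem FiniteEnergy.sub_ne_zero {x : EucSp d} {γ : Config d} (h : FiniteEnergy φ x γ)
    {y : EucSp d} (hy : y ∈ γ.1) : x - y ≠ 0 := by
  rw [_root_.sub_ne_zero]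
  rintro rfl
  exact h.1 hy

theorem FiniteEnergy.summable_negPot {x : EucSp d} {γ : Config d} (h : FiniteEnergy φ x γ) :
    Summable fun y : γ.1 => negPot φ (x - y.1) := by
  refine h.hasSum.summable.abs.of_nonneg_of_le (fun y => negPot_nonneg _ _) fun y => ?_
  rw [negPot, if_neg (h.sub_ne_zero y.2)]
  exact max_le (abs_nonneg _) (neg_le_abs _)

theorem FiniteEnergy.mul_le {x : EucSp d} {γ : Config d} (h : FiniteEnergy φ x γ) {t : ℝ}
    (h0 : -1 ≤ t) (h1 : t ≤ 0) :
    t * (energy φ x γ.1).toReal ≤ ∑' y : γ.1, negPot φ (x - y.1) := by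
  rw [← h.hasSum.tsum_eq, ← tsum_mul_left]
  refine (h.hasSum.summable.mul_left t).tsum_le_tsum (fun y => ?_) h.summable_negPot
  nlinarith [negPot_nonneg φ (x - y.1), neg_toReal_le_negPot φ (h.sub_ne_zero y.2)]

theorem IsC0.summable {f : EucSp d → ℝ} (hf : IsC0 f) (γ : Config d) :
    Summable fun y : γ.1 => f y.1 := by
  refine summable_of_hasFiniteSupport ?_
  refine Set.Finite.of_finite_image (f := Subtype.val) ?_ Subtype.val_injective.injOn
  refine (γ.2 _ hf.2.isCompact).subset ?_
  rintro _ ⟨y, hy, rfl⟩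
  exact ⟨y.2, subset_tsupport _ hy⟩

theorem IsC0.abs {f : EucSp d → ℝ} (hf : IsC0 f) : IsC0 fun x => |f x| :=
  ⟨hf.1.abs, hf.2.comp_left abs_zero⟩

theorem IsC0.mul_cpair_le {f : EucSp d → ℝ} (hf : IsC0 f) (γ : Config d) {c : ℝ}
    (h0 : 0 ≤ c) (h2 : c ≤ 2) : c * cpair f γ ≤ ∑' y : γ.1, 2 * |f y.1| := by
  rw [cpair, ← tsum_mul_left]
  refine ((hf.summable γ).mul_left c).tsum_le_tsum (fun y => ?_) ((hf.abs.summable γ).mul_left 2)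
  nlinarith [le_abs_self (f y.1), abs_nonneg (f y.1)]

/-- A dominating function for the exponentials of relative energies at four points. -/
def expDom (φ : EucSp d → EReal) (f : EucSp d → ℝ) (x₁ x₂ x₃ x₄ : EucSp d) (γ : Config d) : ℝ :=
  Real.exp (∑' y : γ.1, (negPot φ (x₁ - y.1) + negPot φ (x₂ - y.1) + negPot φ (x₃ - y.1) +
    negPot φ (x₄ - y.1) + 2 * |f y.1|))

theorem exp_le_expDom {f : EucSp d → ℝ} (hf : IsC0 f) {γ : Config d} {x₁ x₂ x₃ x₄ : EucSp d}
    (h₁ : FiniteEnergy φ x₁ γ) (h₂ : FiniteEnergy φ x₂ γ) (h₃ : FiniteEnergy φ x₃ γ)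
    (h₄ : FiniteEnergy φ x₄ γ) {t₁ t₂ t₃ t₄ c : ℝ} (ht₁ : t₁ ∈ Icc (-1) 0)
    (ht₂ : t₂ ∈ Icc (-1) 0) (ht₃ : t₃ ∈ Icc (-1) 0) (ht₄ : t₄ ∈ Icc (-1) 0) (hc : c ∈ Icc 0 2) :
    Real.exp (t₁ * (energy φ x₁ γ.1).toReal + t₂ * (energy φ x₂ γ.1).toReal +
      t₃ * (energy φ x₃ γ.1).toReal + t₄ * (energy φ x₄ γ.1).toReal + c * cpair f γ)
      ≤ expDom φ f x₁ x₂ x₃ x₄ γ := by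
  have s₁ := h₁.summable_negPot
  have s₂ := h₂.summable_negPot
  have s₃ := h₃.summable_negPot
  have s₄ := h₄.summable_negPot
  rw [expDom, (((s₁.add s₂).add s₃).add s₄).tsum_add ((hf.abs.summable γ).mul_left 2),
    ((s₁.add s₂).add s₃).tsum_add s₄, (s₁.add s₂).tsum_add s₃, s₁.tsum_add s₂]
  gcongr
  exacts [h₁.mul_le ht₁.1 ht₁.2, h₂.mul_le ht₂.1 ht₂.2, h₃.mul_le ht₃.1 ht₃.2,
    h₄.mul_le ht₄.1 ht₄.2, hf.mul_cpair_le γ hc.1 hc.2]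

theorem IsC0.exists_abs_le {f : EucSp d → ℝ} (hf : IsC0 f) : ∃ C, ∀ x, |f x| ≤ C := by
  obtain ⟨C, hC⟩ := hf.1.bounded_above_of_compact_support hf.2
  exact ⟨C, hC⟩

theorem Setting.exists_lintegral_expDom_le (hset : Setting d s z B ξ φ μ k u)
    {f : EucSp d → ℝ} (hf : IsC0 f) :
    ∃ K : ℝ≥0∞, K ≠ ⊤ ∧ ∀ x₁ x₂ x₃ x₄,
      ∫⁻ γ, ENNReal.ofReal (expDom φ f x₁ x₂ x₃ x₄ γ) ∂μ ≤ K := by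
  have := hset.prob
  obtain ⟨C, hC⟩ := hf.exists_abs_le
  have hn := negPot_nonneg φ
  have hB := hset.stable.negPot_le hset.hB hset.pp
  have hm := measurable_negPot hset.pp.meas
  have hfm := hf.1.measurable
  set N := ∫⁻ y, ENNReal.ofReal (negPot φ y)
  set A := ∫⁻ y, ENNReal.ofReal (2 * |f y|)
  have hN : N ≠ ⊤ := ((lintegral_mono fun y => ENNReal.ofReal_le_ofReal
    (hset.pp.negPot_le_abs y)).trans_lt (hset.laht.lintegral_ne_top hset.hz).lt_top).ne
  have hA : A ≠ ⊤ := by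
    have := ((hf.1.integrable_of_hasCompactSupport (μ := volume)
      hf.2).abs.const_mul 2).lintegral_lt_top.ne
    exact this
  refine ⟨expSeries (ENNReal.ofReal ξ *
    (ENNReal.ofReal (Real.exp (2 * B + 2 * B + 2 * B + 2 * B + 2 * C)) * (N + N + N + N + A))),
    expSeries_ne_top ?_, fun x₁ x₂ x₃ x₄ => ?_⟩
  · exact ENNReal.mul_ne_top ENNReal.ofReal_ne_top
      (ENNReal.mul_ne_top ENNReal.ofReal_ne_top (by simp [hN, hA]))
  · refine (lintegral_exp_tsum_le hset.hξ.le hset.corr hset.ruelle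
      (ψ := fun y => negPot φ (x₁ - y) + negPot φ (x₂ - y) + negPot φ (x₃ - y) +
        negPot φ (x₄ - y) + 2 * |f y|) (M := 2 * B + 2 * B + 2 * B + 2 * B + 2 * C)
      (by fun_prop) (fun y => ?_) fun y => ?_).trans_eq ?_
    · have := hn (x₁ - y); have := hn (x₂ - y); have := hn (x₃ - y); have := hn (x₄ - y)
      positivity
    · gcongr
      exacts [hB _, hB _, hB _, hB _, hC _]
    · congr 2
      have h (x y : EucSp d) := hn (x - y)
      simp_rw [ENNReal.ofReal_mul (Real.exp_nonneg _)]
      rw [lintegral_const_mul' _ _ ENNReal.ofReal_ne_top]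
      congr 1
      calc _ = ∫⁻ y, (ENNReal.ofReal (negPot φ (x₁ - y)) + ENNReal.ofReal (negPot φ (x₂ - y)) +
            ENNReal.ofReal (negPot φ (x₃ - y)) + ENNReal.ofReal (negPot φ (x₄ - y)) +
            ENNReal.ofReal (2 * |f y|)) := by
            refine lintegral_congr fun y => ?_
            have := h x₁ y; have := h x₂ y; have := h x₃ y; have := h x₄ y
            rw [ENNReal.ofReal_add (by positivity) (by positivity),
              ENNReal.ofReal_add (by positivity) (by positivity),
              ENNReal.ofReal_add (by positivity) (by positivity),
              ENNReal.ofReal_add (by positivity) (by positivity)]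
        _ = _ := by
            have hm' (x : EucSp d) : Measurable fun y => ENNReal.ofReal (negPot φ (x - y)) := by
              fun_prop
            have ht (x : EucSp d) : ∫⁻ y, ENNReal.ofReal (negPot φ (x - y)) = N :=
              lintegral_sub_left_eq_self (fun y => ENNReal.ofReal (negPot φ y)) x
            rw [lintegral_add_right _ (by fun_prop), lintegral_add_right _ (hm' _),
              lintegral_add_right _ (hm' _), lintegral_add_right _ (hm' _),
              ht, ht, ht, ht]

end Estimates

/-! ### The Kawasaki birth rate on exponential functions -/

section BirthRate

variable {d : ℕ} {s z B ξ : ℝ} {φ : EucSp d → EReal} {μ : Measure (Config d)}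
  {k u : ∀ n : ℕ, (Fin n → EucSp d) → ℝ} {f : EucSp d → ℝ} {aa : EucSp d → ℝ}

theorem energy_eq_of_hasSum {x : EucSp d} {γ : Set (EucSp d)} {e : ℝ}
    (h : ∀ y ∈ γ, φ (x - y) ≠ ⊤) (he : HasSum (fun y : γ => (φ (x - y.1)).toReal) e) :
    energy φ x γ = e := by
  rw [energy, if_pos ⟨h, he.summable⟩, he.tsum_eq]

theorem IsC0.cpair_ins (hf : IsC0 f) {γ : Config d} {x : EucSp d} (hx : x ∉ γ.1) :
    cpair f (γ.ins x) = f x + cpair f γ := by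
  have h := Config.tsum_eq_add_tsum_del (hf.summable (γ.ins x)) (x := x) (mem_insert _ _)
  rwa [Config.del_ins hx] at h

theorem FiniteEnergy.energy_ins {x w : EucSp d} {γ : Config d} (h : FiniteEnergy φ x γ)
    (hφ : IsPairPotential φ) (hw : w ∉ γ.1) (hxw : x ≠ w) :
    energy φ x (γ.ins w).1 = ((φ (x - w)).toReal + (energy φ x γ.1).toReal : ℝ) := by
  refine energy_eq_of_hasSum ?_ ?_
  · rintro y (rfl | hy)
    · exact hφ.finite_off _ (_root_.sub_ne_zero.2 hxw)
    · exact hφ.finite_off _ (h.sub_ne_zero hy)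
  · have h1 : HasSum ((fun y => (φ (x - y)).toReal) ∘ (↑) : ({w} : Set (EucSp d)) → ℝ)
        (φ (x - w)).toReal := by
      have := hasSum_unique ((fun y => (φ (x - y)).toReal) ∘ (↑) : ({w} : Set (EucSp d)) → ℝ)
      simpa using this
    exact h1.add_disjoint (f := fun y => (φ (x - y)).toReal) (disjoint_singleton_left.2 hw) h.hasSum

theorem FiniteEnergy.ins {x w : EucSp d} {γ : Config d} (h : FiniteEnergy φ x γ)
    (hφ : IsPairPotential φ) (hw : w ∉ γ.1) (hxw : x ≠ w) : FiniteEnergy φ x (γ.ins w) := by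
  refine ⟨?_, ?_⟩
  · rintro (h1 | h1)
    exacts [hxw h1, h.1 h1]
  · rw [h.energy_ins hφ hw hxw]
    exact EReal.coe_ne_top _

theorem FiniteEnergy.toReal_ins {x w : EucSp d} {γ : Config d} (h : FiniteEnergy φ x γ)
    (hφ : IsPairPotential φ) (hw : w ∉ γ.1) (hxw : x ≠ w) :
    (energy φ x (γ.ins w).1).toReal = (φ (x - w)).toReal + (energy φ x γ.1).toReal := by
  rw [h.energy_ins hφ hw hxw, EReal.toReal_coe]

/-- The rate of a birth at `y` paired with the point `x`, times the increment of `e^{⟨f,·⟩}`. -/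
def birth (s : ℝ) (aa : EucSp d → ℝ) (φ : EucSp d → EReal) (f : EucSp d → ℝ) (γ : Config d)
    (x y : EucSp d) : ℝ :=
  aa (x - y) * rexp ((s : EReal) * energy φ x γ.1 + ((s - 1 : ℝ) : EReal) * energy φ y γ.1) *
    Dplus (fun γ' => Real.exp (cpair f γ')) y γ

theorem HepsPlus_eq_tsum_birth (γ : Config d) :
    HepsPlus s aa φ (fun γ' => Real.exp (cpair f γ')) γ
      = -∑' x : γ.1, ∫ y, birth s aa φ f (γ.del x.1) x.1 y := rfl

@[fun_prop]
theorem Measurable.birth (haa : Measurable aa) (hφ : Measurable φ) (hf : Measurable f)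
    {Ω : Type*} [MeasurableSpace Ω] {g : Ω → Config d} {x y : Ω → EucSp d} (hg : Measurable g)
    (hx : Measurable x) (hy : Measurable y) :
    Measurable fun ω => birth s aa φ f (g ω) (x ω) (y ω) := by
  unfold _root_.birth Dplus
  have h1 := measurable_energy hφ hg hx
  have h2 := measurable_energy hφ hg hy
  have h3 := measurable_cpair hf hg
  have h4 := measurable_cpair hf (hg.config_ins hy)
  have h5 := measurable_rexp.comp
    ((h1.const_mul (s : EReal)).add (h2.const_mul ((s - 1 : ℝ) : EReal)))
  exact ((haa.comp (hx.sub hy)).mul h5).mul (h4.exp.sub h3.exp)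

theorem FiniteEnergy.papangelou_eq {γ : Config d} {x : EucSp d} (hx : FiniteEnergy φ x γ) :
    papangelou z φ γ x = z * Real.exp (-(energy φ x γ.1).toReal) := by
  rw [papangelou, ← hx.coe_toReal, ← EReal.coe_neg, rexp_coe, EReal.toReal_coe]

theorem birth_eq (hf : IsC0 f) {γ : Config d} {x y : EucSp d} (hx : FiniteEnergy φ x γ)
    (hy : FiniteEnergy φ y γ) :
    birth s aa φ f γ x y = (Real.exp (f y) - 1) * aa (x - y) *
      Real.exp (s * (energy φ x γ.1).toReal + (s - 1) * (energy φ y γ.1).toReal + cpair f γ) := by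
  rw [birth, Dplus, hf.cpair_ins hy.1, ← hx.coe_toReal, ← hy.coe_toReal]
  simp only [← EReal.coe_mul, ← EReal.coe_add, rexp_coe, EReal.toReal_coe, Real.exp_add]
  ring

theorem papangelou_mul_birth (hf : IsC0 f) {γ : Config d} {x y : EucSp d}
    (hx : FiniteEnergy φ x γ) (hy : FiniteEnergy φ y γ) :
    papangelou z φ γ x * birth s aa φ f γ x y = z * ((Real.exp (f y) - 1) * aa (x - y)) *
      Real.exp ((s - 1) * (energy φ x γ.1).toReal + (s - 1) * (energy φ y γ.1).toReal +
        cpair f γ) := by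
  rw [birth_eq hf hx hy, hx.papangelou_eq]
  generalize (energy φ x γ.1).toReal = a
  generalize (energy φ y γ.1).toReal = b
  have : Real.exp (-a) * Real.exp (s * a + (s - 1) * b + cpair f γ)
      = Real.exp ((s - 1) * a + (s - 1) * b + cpair f γ) := by
    rw [← Real.exp_add]
    ring_nf
  linear_combination z * ((Real.exp (f y) - 1) * aa (x - y)) * this

/-- The integrand of the `μ`-integral in the diagonal term. -/
def diagExp (s : ℝ) (φ : EucSp d → EReal) (f : EucSp d → ℝ) (x y₁ y₂ : EucSp d) (γ : Config d) :
    ℝ :=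
  rexp (((2 * s - 1 : ℝ) : EReal) * energy φ x γ.1 + ((s - 1 : ℝ) : EReal) * energy φ y₁ γ.1 +
    ((s - 1 : ℝ) : EReal) * energy φ y₂ γ.1 + ((2 * cpair f γ : ℝ) : EReal))

/-- The integrand of the `μ`-integral in the off-diagonal term. -/
def offDiagExp (s : ℝ) (φ : EucSp d → EReal) (f : EucSp d → ℝ) (y₁ y₂ x₁ x₂ : EucSp d)
    (γ : Config d) : ℝ :=
  rexp (((s - 1 : ℝ) : EReal) * energy φ y₁ γ.1 + ((s - 1 : ℝ) : EReal) * energy φ y₂ γ.1 +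
    ((s - 1 : ℝ) : EReal) * energy φ x₁ γ.1 + ((s - 1 : ℝ) : EReal) * energy φ x₂ γ.1 +
    ((2 * cpair f γ : ℝ) : EReal))

/-- The interaction factor between the four points of the off-diagonal term. -/
def pairExp (s : ℝ) (φ : EucSp d → EReal) (y₁ y₂ x₁ x₂ : EucSp d) : ℝ :=
  rexp (((2 * s - 1 : ℝ) : EReal) * φ (x₁ - x₂) + ((s - 1 : ℝ) : EReal) * φ (x₁ - y₂) +
    ((s - 1 : ℝ) : EReal) * φ (y₁ - x₂))

theorem diagExp_eq {γ : Config d} {x y₁ y₂ : EucSp d} (hx : FiniteEnergy φ x γ)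
    (hy₁ : FiniteEnergy φ y₁ γ) (hy₂ : FiniteEnergy φ y₂ γ) :
    diagExp s φ f x y₁ y₂ γ = Real.exp ((2 * s - 1) * (energy φ x γ.1).toReal +
      (s - 1) * (energy φ y₁ γ.1).toReal + (s - 1) * (energy φ y₂ γ.1).toReal +
      2 * cpair f γ) := by
  rw [diagExp, ← hx.coe_toReal, ← hy₁.coe_toReal, ← hy₂.coe_toReal]
  simp only [← EReal.coe_mul, ← EReal.coe_add, rexp_coe, EReal.toReal_coe]

theorem offDiagExp_eq {γ : Config d} {y₁ y₂ x₁ x₂ : EucSp d} (hy₁ : FiniteEnergy φ y₁ γ)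
    (hy₂ : FiniteEnergy φ y₂ γ) (hx₁ : FiniteEnergy φ x₁ γ) (hx₂ : FiniteEnergy φ x₂ γ) :
    offDiagExp s φ f y₁ y₂ x₁ x₂ γ = Real.exp ((s - 1) * (energy φ y₁ γ.1).toReal +
      (s - 1) * (energy φ y₂ γ.1).toReal + (s - 1) * (energy φ x₁ γ.1).toReal +
      (s - 1) * (energy φ x₂ γ.1).toReal + 2 * cpair f γ) := by
  rw [offDiagExp, ← hx₁.coe_toReal, ← hx₂.coe_toReal, ← hy₁.coe_toReal, ← hy₂.coe_toReal]
  simp only [← EReal.coe_mul, ← EReal.coe_add, rexp_coe, EReal.toReal_coe]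

theorem IsPairPotential.pairExp_eq (hφ : IsPairPotential φ) {y₁ y₂ x₁ x₂ : EucSp d}
    (h₁ : x₁ ≠ x₂) (h₂ : x₁ ≠ y₂) (h₃ : y₁ ≠ x₂) :
    pairExp s φ y₁ y₂ x₁ x₂ = Real.exp ((2 * s - 1) * (φ (x₁ - x₂)).toReal +
      (s - 1) * (φ (x₁ - y₂)).toReal + (s - 1) * (φ (y₁ - x₂)).toReal) := by
  rw [pairExp, ← hφ.coe_toReal (sub_ne_zero.2 h₁), ← hφ.coe_toReal (sub_ne_zero.2 h₂),
    ← hφ.coe_toReal (sub_ne_zero.2 h₃)]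
  simp only [← EReal.coe_mul, ← EReal.coe_add, rexp_coe, EReal.toReal_coe]

@[fun_prop]
theorem Measurable.pairExp (hφ : Measurable φ) {Ω : Type*} [MeasurableSpace Ω]
    {y₁ y₂ x₁ x₂ : Ω → EucSp d} (hy₁ : Measurable y₁) (hy₂ : Measurable y₂) (hx₁ : Measurable x₁)
    (hx₂ : Measurable x₂) : Measurable fun ω => pairExp s φ (y₁ ω) (y₂ ω) (x₁ ω) (x₂ ω) := by
  unfold _root_.pairExp
  exact measurable_rexp.comp ((((hφ.comp (hx₁.sub hx₂)).const_mul ((2 * s - 1 : ℝ) : EReal)).add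
    ((hφ.comp (hx₁.sub hy₂)).const_mul ((s - 1 : ℝ) : EReal))).add
    ((hφ.comp (hy₁.sub hx₂)).const_mul ((s - 1 : ℝ) : EReal)))

theorem Setting.pairExp_le (hset : Setting d s z B ξ φ μ k u) {y₁ y₂ x₁ x₂ : EucSp d}
    (h₁ : x₁ ≠ x₂) (h₂ : x₁ ≠ y₂) (h₃ : y₁ ≠ x₂) :
    pairExp s φ y₁ y₂ x₁ x₂ ≤ Real.exp (6 * B) := by
  have hs0 := hset.hs0
  have hs1 := hset.hs1
  have hB := hset.hB
  have h {v : EucSp d} (hv : v ≠ 0) := hset.stable.neg_le_toReal hset.pp hv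
  rw [hset.pp.pairExp_eq h₁ h₂ h₃]
  gcongr
  nlinarith [h (sub_ne_zero.2 h₁), h (sub_ne_zero.2 h₂), h (sub_ne_zero.2 h₃)]

theorem papangelou_mul_birth_mul_birth (hf : IsC0 f) {γ : Config d} {x y₁ y₂ : EucSp d}
    (hx : FiniteEnergy φ x γ) (hy₁ : FiniteEnergy φ y₁ γ) (hy₂ : FiniteEnergy φ y₂ γ) :
    papangelou z φ γ x * (birth s aa φ f γ x y₁ * birth s aa φ f γ x y₂)
      = z * (((Real.exp (f y₁) - 1) * aa (x - y₁)) * ((Real.exp (f y₂) - 1) * aa (x - y₂))) *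
        diagExp s φ f x y₁ y₂ γ := by
  rw [birth_eq hf hx hy₁, birth_eq hf hx hy₂, hx.papangelou_eq, diagExp_eq hx hy₁ hy₂]
  generalize (energy φ x γ.1).toReal = a
  generalize (energy φ y₁ γ.1).toReal = b
  generalize (energy φ y₂ γ.1).toReal = c
  have : Real.exp (-a) * Real.exp (s * a + (s - 1) * b + cpair f γ) *
      Real.exp (s * a + (s - 1) * c + cpair f γ)
      = Real.exp ((2 * s - 1) * a + (s - 1) * b + (s - 1) * c + 2 * cpair f γ) := by
    simp only [← Real.exp_add]
    ring_nf
  linear_combination z * (((Real.exp (f y₁) - 1) * aa (x - y₁)) *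
    ((Real.exp (f y₂) - 1) * aa (x - y₂))) * this

theorem papangelou_mul_offDiag (hφ : IsPairPotential φ) (hf : IsC0 f) {γ : Config d}
    {y₁ y₂ x₁ x₂ : EucSp d} (hy₁ : FiniteEnergy φ y₁ γ) (hy₂ : FiniteEnergy φ y₂ γ)
    (hx₁ : FiniteEnergy φ x₁ γ) (hx₂ : FiniteEnergy φ x₂ γ)
    (h₁ : x₁ ≠ x₂) (h₂ : x₁ ≠ y₂) (h₃ : y₁ ≠ x₂) :
    papangelou z φ γ x₁ * (papangelou z φ (γ.ins x₁) x₂ *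
        birth s aa φ f (γ.ins x₁) x₂ y₂ * birth s aa φ f (γ.ins x₂) x₁ y₁)
      = z * z * (((Real.exp (f y₁) - 1) * aa (x₁ - y₁)) * ((Real.exp (f y₂) - 1) * aa (x₂ - y₂))) *
        (Real.exp (f x₁) * Real.exp (f x₂) * pairExp s φ y₁ y₂ x₁ x₂) *
        offDiagExp s φ f y₁ y₂ x₁ x₂ γ := by
  have e₁ : φ (x₂ - x₁) = φ (x₁ - x₂) := by
    rw [← neg_sub, hφ.even _ (sub_ne_zero.2 h₁)]
  have e₂ : φ (y₂ - x₁) = φ (x₁ - y₂) := by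
    rw [← neg_sub, hφ.even _ (sub_ne_zero.2 h₂)]
  rw [birth_eq hf (hx₁.ins hφ hx₂.1 h₁) (hy₁.ins hφ hx₂.1 h₃),
    birth_eq hf (hx₂.ins hφ hx₁.1 h₁.symm) (hy₂.ins hφ hx₁.1 h₂.symm), hx₁.papangelou_eq,
    (hx₂.ins hφ hx₁.1 h₁.symm).papangelou_eq, hf.cpair_ins hx₁.1, hf.cpair_ins hx₂.1,
    hx₁.toReal_ins hφ hx₂.1 h₁, hy₁.toReal_ins hφ hx₂.1 h₃, hx₂.toReal_ins hφ hx₁.1 h₁.symm,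
    hy₂.toReal_ins hφ hx₁.1 h₂.symm, e₁, e₂, hφ.pairExp_eq h₁ h₂ h₃,
    offDiagExp_eq hy₁ hy₂ hx₁ hx₂]
  generalize (energy φ x₁ γ.1).toReal = a₁
  generalize (energy φ x₂ γ.1).toReal = a₂
  generalize (energy φ y₁ γ.1).toReal = b₁
  generalize (energy φ y₂ γ.1).toReal = b₂
  generalize (φ (x₁ - x₂)).toReal = t₁
  generalize (φ (x₁ - y₂)).toReal = t₂
  generalize (φ (y₁ - x₂)).toReal = t₃
  generalize cpair f γ = c
  have : Real.exp (-a₁) * Real.exp (-(t₁ + a₂)) *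
      Real.exp (s * (t₁ + a₁) + (s - 1) * (t₃ + b₁) + (f x₂ + c)) *
      Real.exp (s * (t₁ + a₂) + (s - 1) * (t₂ + b₂) + (f x₁ + c))
      = Real.exp (f x₁) * Real.exp (f x₂) *
        Real.exp ((2 * s - 1) * t₁ + (s - 1) * t₂ + (s - 1) * t₃) *
        Real.exp ((s - 1) * b₁ + (s - 1) * b₂ + (s - 1) * a₁ + (s - 1) * a₂ + 2 * c) := by
    simp only [← Real.exp_add]
    ring_nf
  linear_combination z * z * (((Real.exp (f y₁) - 1) * aa (x₁ - y₁)) *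
    ((Real.exp (f y₂) - 1) * aa (x₂ - y₂))) * this

end BirthRate

/-! ### Fubini's theorem for iterated integrals -/

section Fubini

theorem integrable_of_ae_eq_mul {Ω X : Type*} [MeasurableSpace Ω] [MeasurableSpace X]
    {μ : Measure Ω} {ν : Measure X} [SFinite μ] [SFinite ν] {W : Ω × X → ℝ} (hW : Measurable W)
    {c : X → ℝ} (hc : Integrable c ν) {h g : X → Ω → ℝ} {K : ℝ≥0∞} (hK : K ≠ ⊤)
    (hg : ∀ q, ∫⁻ γ, ENNReal.ofReal (g q γ) ∂μ ≤ K)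
    (hWc : ∀ᵐ q ∂ν, ∀ᵐ γ ∂μ, W (γ, q) = c q * h q γ ∧ |h q γ| ≤ g q γ) :
    Integrable W (μ.prod ν) ∧ Integrable (fun q => c q * ∫ γ, h q γ ∂μ) ν ∧
      ∫ q, ∫ γ, W (γ, q) ∂μ ∂ν = ∫ q, c q * ∫ γ, h q γ ∂μ ∂ν := by
  have h1 : Integrable W (μ.prod ν) := by
    refine ⟨hW.aestronglyMeasurable, ?_⟩
    rw [HasFiniteIntegral, lintegral_prod_symm' _ hW.enorm]
    calc ∫⁻ q, ∫⁻ γ, ‖W (γ, q)‖ₑ ∂μ ∂ν ≤ ∫⁻ q, ‖c q‖ₑ * K ∂ν := by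
          refine lintegral_mono_ae ?_
          filter_upwards [hWc] with q hq
          calc ∫⁻ γ, ‖W (γ, q)‖ₑ ∂μ ≤ ∫⁻ γ, ‖c q‖ₑ * ENNReal.ofReal (g q γ) ∂μ := by
                refine lintegral_mono_ae ?_
                filter_upwards [hq] with γ hγ
                rw [hγ.1, enorm_mul, ← ofReal_norm (h q γ)]
                gcongr
                exact hγ.2
            _ = ‖c q‖ₑ * ∫⁻ γ, ENNReal.ofReal (g q γ) ∂μ := lintegral_const_mul' _ _ (by simp)
            _ ≤ _ := by
                gcongr
                exact hg q
      _ = (∫⁻ q, ‖c q‖ₑ ∂ν) * K := lintegral_mul_const' _ _ hK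
      _ < ⊤ := ENNReal.mul_lt_top hc.2 hK.lt_top
  have h2 : (fun q => ∫ γ, W (γ, q) ∂μ) =ᵐ[ν] fun q => c q * ∫ γ, h q γ ∂μ := by
    filter_upwards [hWc] with q hq
    rw [← integral_const_mul]
    exact integral_congr_ae (hq.mono fun γ hγ => hγ.1)
  exact ⟨h1, h1.integral_prod_right.congr h2, integral_congr_ae h2⟩

theorem integrable_integral_and_integral_prod {Ω X Y : Type*} [MeasurableSpace Ω]
    [MeasurableSpace X] [MeasurableSpace Y] {μ : Measure Ω} {ν : Measure X} {ρ : Measure Y}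
    [SFinite μ] [SFinite ν] [SFinite ρ] {W : Ω × (X × Y) → ℝ}
    (hW : Integrable W (μ.prod (ν.prod ρ))) :
    Integrable (fun p : Ω × X => ∫ y, W (p.1, (p.2, y)) ∂ρ) (μ.prod ν) ∧
      ∫ p : Ω × X, ∫ y, W (p.1, (p.2, y)) ∂ρ ∂(μ.prod ν)
        = ∫ q, ∫ γ, W (γ, q) ∂μ ∂(ν.prod ρ) := by
  have hp := measurePreserving_prodAssoc μ ν ρ
  have h1 : Integrable (fun p : (Ω × X) × Y => W (p.1.1, (p.1.2, p.2))) ((μ.prod ν).prod ρ) :=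
    hp.integrable_comp_of_integrable hW
  refine ⟨h1.integral_prod_left, ?_⟩
  rw [← integral_prod_symm _ hW, ← hp.integral_comp', ← integral_prod _ h1]
  rfl

theorem integral_prod_prod_eq_integral₃ {X Y Z : Type*} [MeasurableSpace X] [MeasurableSpace Y]
    [MeasurableSpace Z] {ν : Measure X} {ρ : Measure Y} {τ : Measure Z} [SFinite ν] [SFinite ρ]
    [SFinite τ] {V : X × (Y × Z) → ℝ} (hV : Integrable V (ν.prod (ρ.prod τ))) :
    ∫ q, V q ∂(ν.prod (ρ.prod τ)) = ∫ y, ∫ x, ∫ w, V (x, (y, w)) ∂τ ∂ν ∂ρ := by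
  have hp := measurePreserving_prodAssoc ν ρ τ
  have h1 : Integrable (fun p : (X × Y) × Z => V (p.1.1, (p.1.2, p.2))) ((ν.prod ρ).prod τ) :=
    hp.integrable_comp_of_integrable hV
  rw [← hp.integral_comp']
  exact (integral_prod _ h1).trans (integral_prod_symm _ h1.integral_prod_left)

theorem integral_prod_prod_eq_integral₄ {X₁ X₂ Y₁ Y₂ : Type*} [MeasurableSpace X₁]
    [MeasurableSpace X₂] [MeasurableSpace Y₁] [MeasurableSpace Y₂] {ν₁ : Measure X₁}
    {ν₂ : Measure X₂} {ρ₁ : Measure Y₁} {ρ₂ : Measure Y₂} [SFinite ν₁] [SFinite ν₂] [SFinite ρ₁]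
    [SFinite ρ₂] {V : (Y₁ × Y₂) × (X₁ × X₂) → ℝ}
    (hV : Integrable V ((ρ₁.prod ρ₂).prod (ν₁.prod ν₂))) :
    ∫ q, V q ∂((ρ₁.prod ρ₂).prod (ν₁.prod ν₂))
      = ∫ x₁, ∫ x₂, ∫ y₁, ∫ y₂, V ((y₁, y₂), (x₁, x₂)) ∂ρ₂ ∂ρ₁ ∂ν₂ ∂ν₁ := by
  have h1 : (fun x => ∫ y, V (y, x) ∂(ρ₁.prod ρ₂))
      =ᵐ[ν₁.prod ν₂] fun x => ∫ y₁, ∫ y₂, V ((y₁, y₂), x) ∂ρ₂ ∂ρ₁ := by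
    filter_upwards [hV.prod_left_ae] with x hx
    exact integral_prod _ hx
  rw [integral_prod_symm _ hV, integral_congr_ae h1]
  exact integral_prod _ (hV.integral_prod_right.congr h1)

end Fubini

/-! ### Changes of variables -/

section Scaling

variable {d : ℕ} {ε : ℝ} {a : EucSp d → ℝ}

theorem integral_eq_mul_integral_add_smul (hε : 0 < ε) (g : EucSp d → ℝ) (v : EucSp d) :
    ∫ x, g x = ε⁻¹ ^ d * ∫ x, g (v + ε⁻¹ • x) := by
  rw [Measure.integral_comp_smul volume (fun x => g (v + x)), integral_add_left_eq_self,
    finrank_euclideanSpace_fin, abs_of_pos (by positivity), smul_eq_mul, ← mul_assoc,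
    mul_inv_cancel₀ (by positivity), one_mul]

theorem integral_eq_mul_integral_sub_smul (hε : 0 < ε) (g : EucSp d → ℝ) (v : EucSp d) :
    ∫ x, g x = ε⁻¹ ^ d * ∫ x, g (v - ε⁻¹ • x) := by
  rw [Measure.integral_comp_smul volume (fun x => g (v - x)), integral_sub_left_eq_self,
    finrank_euclideanSpace_fin, abs_of_pos (by positivity), smul_eq_mul, ← mul_assoc,
    mul_inv_cancel₀ (by positivity), one_mul]

theorem map_smul_add_volume (hε : 0 < ε) (v : EucSp d) :
    (ENNReal.ofReal (ε⁻¹ ^ d) • (volume : Measure (EucSp d))).map (fun x => ε⁻¹ • x + v)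
      = volume := by
  have h : (fun x : EucSp d => ε⁻¹ • x + v) = (fun x => x + v) ∘ fun x => ε⁻¹ • x := rfl
  rw [h, ← Measure.map_map (by fun_prop) (by fun_prop), Measure.map_smul,
    Measure.map_addHaar_smul _ (by positivity), Measure.map_smul, Measure.map_smul,
    map_add_right_eq_self, finrank_euclideanSpace_fin, abs_of_pos (by positivity), smul_smul,
    ← ENNReal.ofReal_mul (by positivity), mul_inv_cancel₀ (by positivity), ENNReal.ofReal_one,
    one_smul]

/-- The map `(y, x) ↦ (ε⁻¹ x + y, y)` on pairs of points. -/
def shiftPair (d : ℕ) (ε : ℝ) (q : (EucSp d × EucSp d) × (EucSp d × EucSp d)) :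
    (EucSp d × EucSp d) × (EucSp d × EucSp d) :=
  ((ε⁻¹ • q.2.1 + q.1.1, ε⁻¹ • q.2.2 + q.1.2), q.1)

theorem measurePreserving_shiftPair (hε : 0 < ε) :
    MeasurePreserving (shiftPair d ε)
      ((volume.prod volume).prod ((ENNReal.ofReal (ε⁻¹ ^ d) • volume).prod
        (ENNReal.ofReal (ε⁻¹ ^ d) • volume)))
      ((volume.prod volume).prod (volume.prod volume)) := by
  have h := (MeasurePreserving.id
    ((volume : Measure (EucSp d)).prod (volume : Measure (EucSp d)))).skew_product
    (g := fun y x : EucSp d × EucSp d => (ε⁻¹ • x.1 + y.1, ε⁻¹ • x.2 + y.2))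
    (μc := (ENNReal.ofReal (ε⁻¹ ^ d) • (volume : Measure (EucSp d))).prod
      (ENNReal.ofReal (ε⁻¹ ^ d) • (volume : Measure (EucSp d))))
    (μd := (volume : Measure (EucSp d)).prod (volume : Measure (EucSp d)))
    (by fun_prop) (Eventually.of_forall fun y => by
      have := Measure.map_prod_map (ENNReal.ofReal (ε⁻¹ ^ d) • (volume : Measure (EucSp d)))
        (ENNReal.ofReal (ε⁻¹ ^ d) • (volume : Measure (EucSp d)))
        (f := fun x => ε⁻¹ • x + y.1) (g := fun x => ε⁻¹ • x + y.2) (by fun_prop) (by fun_prop)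
      rw [map_smul_add_volume hε, map_smul_add_volume hε] at this
      exact this.symm)
  exact Measure.measurePreserving_swap.comp h

theorem aScaled_smul (hε : 0 < ε) (x : EucSp d) : aScaled a ε (ε⁻¹ • x) = ε ^ d * a x := by
  rw [aScaled, smul_smul, mul_inv_cancel₀ hε.ne', one_smul]

theorem GoodA.aScaled_neg_smul (ha : GoodA a) (hε : 0 < ε) (x : EucSp d) :
    aScaled a ε (-(ε⁻¹ • x)) = ε ^ d * a x := by
  rw [← smul_neg, aScaled_smul hε, ha.even]

theorem GoodA.measurable_aScaled (ha : GoodA a) : Measurable (aScaled a ε) :=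
  (ha.meas.comp (measurable_const_smul ε)).const_mul _

theorem GoodA.integrable_aScaled (ha : GoodA a) (hε : 0 < ε) : Integrable (aScaled a ε) :=
  (ha.int.comp_smul hε.ne').const_mul _

theorem GoodA.exists_aScaled_le (ha : GoodA a) (hε : 0 < ε) : ∃ C, ∀ x, ‖aScaled a ε x‖ ≤ C := by
  obtain ⟨C, hC⟩ := ha.bdd
  refine ⟨ε ^ d * C, fun x => ?_⟩
  have := ha.nonneg (ε • x)
  rw [aScaled, Real.norm_of_nonneg (by positivity)]
  gcongr
  exact hC _

end Scaling

/-! ### Integrability of the coefficients -/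

section Coefficients

variable {d : ℕ} {s z B ξ ε : ℝ} {φ : EucSp d → EReal} {μ : Measure (Config d)}
  {k u : ∀ n : ℕ, (Fin n → EucSp d) → ℝ} {f a : EucSp d → ℝ}

theorem IsC0.exp_sub_one (hf : IsC0 f) : IsC0 fun x => Real.exp (f x) - 1 :=
  ⟨by have := hf.1; fun_prop, hf.2.comp_left (g := fun t => Real.exp t - 1) (by simp)⟩

theorem IsC0.integrable (hf : IsC0 f) : Integrable f :=
  hf.1.integrable_of_hasCompactSupport hf.2

/-- The jump kernel times the increment factor of a birth. -/
def jump (a : EucSp d → ℝ) (ε : ℝ) (f : EucSp d → ℝ) (x y : EucSp d) : ℝ :=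
  (Real.exp (f y) - 1) * aScaled a ε (x - y)

theorem measurable_jump (ha : GoodA a) (hf : IsC0 f) {Ω : Type*} [MeasurableSpace Ω]
    {x y : Ω → EucSp d} (hx : Measurable x) (hy : Measurable y) :
    Measurable fun ω => jump a ε f (x ω) (y ω) := by
  have h1 := ha.measurable_aScaled (ε := ε)
  have h2 := hf.1.measurable
  unfold jump
  fun_prop

theorem integrable_jump (ha : GoodA a) (hε : 0 < ε) (hf : IsC0 f) :
    Integrable (fun p : EucSp d × EucSp d => jump a ε f p.1 p.2) (volume.prod volume) :=
  hf.exp_sub_one.integrable.convolution_integrand (ContinuousLinearMap.mul ℝ ℝ)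
    (ha.integrable_aScaled hε)

theorem integrable_jump_mul_jump (ha : GoodA a) (hε : 0 < ε) (hf : IsC0 f) :
    Integrable (fun q : EucSp d × (EucSp d × EucSp d) =>
      jump a ε f q.1 q.2.1 * jump a ε f q.1 q.2.2) (volume.prod (volume.prod volume)) := by
  have hp := (measurePreserving_prodAssoc (volume : Measure (EucSp d))
    (volume : Measure (EucSp d)) (volume : Measure (EucSp d)))
  rw [← hp.integrable_comp_emb (MeasurableEquiv.measurableEmbedding _)]
  obtain ⟨C, hC⟩ := ha.exists_aScaled_le hε
  have h1 := ha.measurable_aScaled (ε := ε)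
  refine (((integrable_jump ha hε hf).mul_prod hf.exp_sub_one.integrable).mul_bdd (c := C)
    (g := fun p => aScaled a ε (p.1.1 - p.2)) (Measurable.aestronglyMeasurable (by fun_prop))
    (Eventually.of_forall fun p => hC _)).congr (Eventually.of_forall fun p => ?_)
  exact mul_assoc _ _ _

theorem integrable_jump_mul_jump_off (ha : GoodA a) (hε : 0 < ε) (hf : IsC0 f) :
    Integrable (fun q : (EucSp d × EucSp d) × (EucSp d × EucSp d) =>
      jump a ε f q.1.1 q.2.1 * jump a ε f q.1.2 q.2.2)
      ((volume.prod volume).prod (volume.prod volume)) := by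
  have hj : Measurable fun q : (EucSp d × EucSp d) × (EucSp d × EucSp d) =>
      jump a ε f q.1.1 q.2.1 * jump a ε f q.1.2 q.2.2 :=
    (measurable_jump ha hf (by fun_prop) (by fun_prop)).mul
      (measurable_jump ha hf (by fun_prop) (by fun_prop))
  rw [← (measurePreserving_shiftPair hε).integrable_comp hj.aestronglyMeasurable]
  have hb := hf.exp_sub_one.integrable
  have h1 : Integrable (fun x => ε ^ d * a x)
      (ENNReal.ofReal (ε⁻¹ ^ d) • (volume : Measure (EucSp d))) :=
    (ha.int.const_mul _).smul_measure ENNReal.ofReal_ne_top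
  refine ((hb.mul_prod hb).mul_prod (h1.mul_prod h1)).congr (Eventually.of_forall fun q => ?_)
  simp only [jump, shiftPair, Function.comp_apply, add_sub_cancel_right, aScaled_smul hε]
  ring

theorem Setting.ae_fst_ne_snd (hset : Setting d s z B ξ φ μ k u) :
    ∀ᵐ p : EucSp d × EucSp d ∂(volume.prod volume), p.1 ≠ p.2 := by
  have := hset.nullSingletonClass
  refine (Measure.ae_prod_iff_ae_ae ?_).2 (Eventually.of_forall fun x => ?_)
  · exact (measurableSet_eq_fun measurable_fst measurable_snd).compl
  · filter_upwards [(measure_eq_zero_iff_ae_notMem.1 (measure_singleton (μ := volume) x))] with y hy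
    exact fun h => hy h.symm

theorem Setting.ae_ne (hset : Setting d s z B ξ φ μ k u) :
    ∀ᵐ q : (EucSp d × EucSp d) × (EucSp d × EucSp d)
      ∂((volume.prod volume).prod (volume.prod volume)),
      q.1.1 ≠ q.1.2 ∧ q.1.1 ≠ q.2.2 ∧ q.2.1 ≠ q.1.2 := by
  have h := hset.ae_fst_ne_snd
  have h1 := (Measure.quasiMeasurePreserving_fst
    (μ := (volume : Measure (EucSp d)).prod (volume : Measure (EucSp d)))
    (ν := (volume : Measure (EucSp d)).prod (volume : Measure (EucSp d)))).ae h
  have h2 := QuasiMeasurePreserving.prodMap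
    (Measure.quasiMeasurePreserving_fst (μ := (volume : Measure (EucSp d)))
    (ν := (volume : Measure (EucSp d)))) (Measure.quasiMeasurePreserving_snd
    (μ := (volume : Measure (EucSp d))) (ν := (volume : Measure (EucSp d))))
  have h3 := QuasiMeasurePreserving.prodMap
    (Measure.quasiMeasurePreserving_snd (μ := (volume : Measure (EucSp d)))
    (ν := (volume : Measure (EucSp d)))) (Measure.quasiMeasurePreserving_fst
    (μ := (volume : Measure (EucSp d))) (ν := (volume : Measure (EucSp d))))
  filter_upwards [h1, h2.ae h, h3.ae h] with q h1 h2 h3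
  exact ⟨h1, h2, h3.symm⟩

theorem pairExp_nonneg (y₁ y₂ x₁ x₂ : EucSp d) : 0 ≤ pairExp s φ y₁ y₂ x₁ x₂ := rexp_nonneg _

theorem Setting.integrable_offDiag_coeff (hset : Setting d s z B ξ φ μ k u) (ha : GoodA a)
    (hε : 0 < ε) (hf : IsC0 f) :
    Integrable (fun q : (EucSp d × EucSp d) × (EucSp d × EucSp d) =>
      z * z * (jump a ε f q.1.1 q.2.1 * jump a ε f q.1.2 q.2.2) *
        (Real.exp (f q.1.1) * Real.exp (f q.1.2) * pairExp s φ q.2.1 q.2.2 q.1.1 q.1.2))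
      ((volume.prod volume).prod (volume.prod volume)) := by
  obtain ⟨C, hC⟩ := hf.exists_abs_le
  have hfm := hf.1.measurable
  have hφm := hset.pp.meas
  have hg : Measurable fun q : (EucSp d × EucSp d) × (EucSp d × EucSp d) =>
      Real.exp (f q.1.1) * Real.exp (f q.1.2) * pairExp s φ q.2.1 q.2.2 q.1.1 q.1.2 := by
    fun_prop
  refine ((integrable_jump_mul_jump_off ha hε hf).const_mul (z * z)).mul_bdd
    (c := Real.exp C * Real.exp C * Real.exp (6 * B)) hg.aestronglyMeasurable ?_
  filter_upwards [hset.ae_ne] with q hq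
  have h0 := pairExp_nonneg (s := s) (φ := φ) q.2.1 q.2.2 q.1.1 q.1.2
  have h1 := (le_abs_self _).trans (hC q.1.1)
  have h2 := (le_abs_self _).trans (hC q.1.2)
  rw [Real.norm_of_nonneg (by positivity)]
  gcongr
  exact hset.pairExp_le hq.1 hq.2.1 hq.2.2

end Coefficients

/-! ### The second moment as a sum of two integrals over pairs and quadruples of points -/

section SecondMoment

variable {d : ℕ} {s z B ξ ε : ℝ} {φ : EucSp d → EReal} {μ : Measure (Config d)}
  {k u : ∀ n : ℕ, (Fin n → EucSp d) → ℝ} {f a : EucSp d → ℝ}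

/-- The total rate of births paired with the point `x`, weighted by the increments of
`e^{⟨f,·⟩}`. -/
def totalBirth (s : ℝ) (aa : EucSp d → ℝ) (φ : EucSp d → EReal) (f : EucSp d → ℝ)
    (p : Config d × EucSp d) : ℝ :=
  ∫ y, birth s aa φ f p.1 p.2 y

theorem measurable_totalBirth {aa : EucSp d → ℝ} (haa : Measurable aa) (hφ : Measurable φ)
    (hf : Measurable f) : Measurable (totalBirth s aa φ f) := by
  refine (StronglyMeasurable.integral_prod_right
    (f := fun (p : Config d × EucSp d) y => birth s aa φ f p.1 p.2 y)
    (Measurable.stronglyMeasurable ?_)).measurable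
  unfold Function.uncurry
  fun_prop

theorem Setting.sub_one_mem (hset : Setting d s z B ξ φ μ k u) : s - 1 ∈ Icc (-1 : ℝ) 0 :=
  ⟨by linarith [hset.hs0], by linarith [hset.hs1]⟩

theorem Setting.two_mul_sub_one_mem (hset : Setting d s z B ξ φ μ k u) :
    2 * s - 1 ∈ Icc (-1 : ℝ) 0 :=
  ⟨by linarith [hset.hs0], by linarith [hset.hs1]⟩

theorem Setting.integrable_papangelou_mul_totalBirth (hset : Setting d s z B ξ φ μ k u)
    (ha : GoodA a) (hε : 0 < ε) (hf : IsC0 f) :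
    Integrable (fun p : Config d × EucSp d => papangelou z φ p.1 p.2 *
      totalBirth s (aScaled a ε) φ f p) (μ.prod volume) := by
  have := hset.prob
  have haa := ha.measurable_aScaled (ε := ε)
  have hfm := hf.1.measurable
  have hφ := hset.pp.meas
  obtain ⟨K, hK, hdom⟩ := hset.exists_lintegral_expDom_le hf
  have hW : Measurable fun r : Config d × (EucSp d × EucSp d) => papangelou z φ r.1 r.2.1 *
      birth s (aScaled a ε) φ f r.1 r.2.1 r.2.2 :=
    (measurable_papangelou hφ (by fun_prop) (by fun_prop)).mul (by fun_prop)
  have h := integrable_of_ae_eq_mul hW ((integrable_jump ha hε hf).const_mul z)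
    (h := fun q γ => Real.exp ((s - 1) * (energy φ q.1 γ.1).toReal +
      (s - 1) * (energy φ q.2 γ.1).toReal + cpair f γ))
    (g := fun q => expDom φ f q.1 q.2 q.1 q.2) hK (fun q => hdom _ _ _ _)
    (Eventually.of_forall fun q => ?_)
  · refine (integrable_integral_and_integral_prod h.1).1.congr (Eventually.of_forall fun p => ?_)
    exact integral_const_mul (papangelou z φ p.1 p.2) (birth s (aScaled a ε) φ f p.1 p.2)
  · filter_upwards [hset.ae_finiteEnergy q.1, hset.ae_finiteEnergy q.2] with γ h1 h2
    refine ⟨papangelou_mul_birth hf h1 h2, ?_⟩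
    rw [Real.abs_exp]
    have := exp_le_expDom hf h1 h2 h1 h2 hset.sub_one_mem hset.sub_one_mem
      (t₃ := 0) (t₄ := 0) (by simp) (by simp) (c := 1) (by norm_num)
    simpa using this

theorem Setting.integrable_papangelou_mul_totalBirth_sq (hset : Setting d s z B ξ φ μ k u)
    (ha : GoodA a) (hε : 0 < ε) (hf : IsC0 f) :
    Integrable (fun p : Config d × EucSp d => papangelou z φ p.1 p.2 *
      totalBirth s (aScaled a ε) φ f p ^ 2) (μ.prod volume) ∧
    Integrable (fun q : EucSp d × (EucSp d × EucSp d) =>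
      z * (jump a ε f q.1 q.2.1 * jump a ε f q.1 q.2.2) *
        ∫ γ, diagExp s φ f q.1 q.2.1 q.2.2 γ ∂μ) (volume.prod (volume.prod volume)) ∧
    ∫ p : Config d × EucSp d, papangelou z φ p.1 p.2 *
      totalBirth s (aScaled a ε) φ f p ^ 2 ∂(μ.prod volume)
      = ∫ q : EucSp d × (EucSp d × EucSp d),
        z * (jump a ε f q.1 q.2.1 * jump a ε f q.1 q.2.2) *
          ∫ γ, diagExp s φ f q.1 q.2.1 q.2.2 γ ∂μ ∂(volume.prod (volume.prod volume)) := by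
  have := hset.prob
  have haa := ha.measurable_aScaled (ε := ε)
  have hfm := hf.1.measurable
  have hφ := hset.pp.meas
  obtain ⟨K, hK, hdom⟩ := hset.exists_lintegral_expDom_le hf
  have hW : Measurable fun r : Config d × (EucSp d × (EucSp d × EucSp d)) =>
      papangelou z φ r.1 r.2.1 * (birth s (aScaled a ε) φ f r.1 r.2.1 r.2.2.1 *
        birth s (aScaled a ε) φ f r.1 r.2.1 r.2.2.2) :=
    (measurable_papangelou hφ (by fun_prop) (by fun_prop)).mul (by fun_prop)
  obtain ⟨h1, h2, h3⟩ := integrable_of_ae_eq_mul hW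
    ((integrable_jump_mul_jump ha hε hf).const_mul z)
    (h := fun q γ => diagExp s φ f q.1 q.2.1 q.2.2 γ)
    (g := fun q => expDom φ f q.1 q.2.1 q.2.2 q.1) hK (fun q => hdom _ _ _ _)
    (Eventually.of_forall fun q => by
      filter_upwards [hset.ae_finiteEnergy q.1, hset.ae_finiteEnergy q.2.1,
        hset.ae_finiteEnergy q.2.2] with γ h1 h2 h3
      refine ⟨papangelou_mul_birth_mul_birth hf h1 h2 h3, ?_⟩
      rw [diagExp_eq h1 h2 h3, Real.abs_exp]
      have := exp_le_expDom hf h1 h2 h3 h1 hset.two_mul_sub_one_mem hset.sub_one_mem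
        hset.sub_one_mem (t₄ := 0) (by simp) (c := 2) (by norm_num)
      simpa using this)
  have h4 := integrable_integral_and_integral_prod h1
  have h5 : (fun p : Config d × EucSp d => ∫ y : EucSp d × EucSp d, papangelou z φ p.1 p.2 *
      (birth s (aScaled a ε) φ f p.1 p.2 y.1 * birth s (aScaled a ε) φ f p.1 p.2 y.2)
        ∂(volume.prod volume))
      = fun p => papangelou z φ p.1 p.2 * totalBirth s (aScaled a ε) φ f p ^ 2 := by
    ext p
    rw [integral_const_mul, integral_prod_mul, sq]
    rfl
  rw [← h5]
  exact ⟨h4.1, h2, h4.2.trans h3⟩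

theorem Setting.integrable_papangelou_mul_offDiagMecke (hset : Setting d s z B ξ φ μ k u)
    (ha : GoodA a) (hε : 0 < ε) (hf : IsC0 f) :
    Integrable (fun p : (Config d × EucSp d) × EucSp d => papangelou z φ p.1.1 p.1.2 *
      offDiagMecke z φ (totalBirth s (aScaled a ε) φ f) p) ((μ.prod volume).prod volume) ∧
    Integrable (fun q : (EucSp d × EucSp d) × (EucSp d × EucSp d) =>
      z * z * (jump a ε f q.1.1 q.2.1 * jump a ε f q.1.2 q.2.2) *
        (Real.exp (f q.1.1) * Real.exp (f q.1.2) * pairExp s φ q.2.1 q.2.2 q.1.1 q.1.2) *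
        ∫ γ, offDiagExp s φ f q.2.1 q.2.2 q.1.1 q.1.2 γ ∂μ)
      ((volume.prod volume).prod (volume.prod volume)) ∧
    ∫ p : (Config d × EucSp d) × EucSp d, papangelou z φ p.1.1 p.1.2 *
      offDiagMecke z φ (totalBirth s (aScaled a ε) φ f) p ∂((μ.prod volume).prod volume)
      = ∫ q : (EucSp d × EucSp d) × (EucSp d × EucSp d),
        z * z * (jump a ε f q.1.1 q.2.1 * jump a ε f q.1.2 q.2.2) *
          (Real.exp (f q.1.1) * Real.exp (f q.1.2) * pairExp s φ q.2.1 q.2.2 q.1.1 q.1.2) *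
          ∫ γ, offDiagExp s φ f q.2.1 q.2.2 q.1.1 q.1.2 γ ∂μ
          ∂((volume.prod volume).prod (volume.prod volume)) := by
  have := hset.prob
  have haa := ha.measurable_aScaled (ε := ε)
  have hfm := hf.1.measurable
  have hφ := hset.pp.meas
  obtain ⟨K, hK, hdom⟩ := hset.exists_lintegral_expDom_le hf
  have hW : Measurable fun r : Config d × ((EucSp d × EucSp d) × (EucSp d × EucSp d)) =>
      papangelou z φ r.1 r.2.1.1 * (papangelou z φ (r.1.ins r.2.1.1) r.2.1.2 *
        birth s (aScaled a ε) φ f (r.1.ins r.2.1.1) r.2.1.2 r.2.2.2 *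
        birth s (aScaled a ε) φ f (r.1.ins r.2.1.2) r.2.1.1 r.2.2.1) :=
    (measurable_papangelou hφ (by fun_prop) (by fun_prop)).mul
      (((measurable_papangelou hφ (by fun_prop) (by fun_prop)).mul (by fun_prop)).mul
        (by fun_prop))
  obtain ⟨h1, h2, h3⟩ := integrable_of_ae_eq_mul hW (hset.integrable_offDiag_coeff ha hε hf)
    (h := fun q γ => offDiagExp s φ f q.2.1 q.2.2 q.1.1 q.1.2 γ)
    (g := fun q => expDom φ f q.2.1 q.2.2 q.1.1 q.1.2) hK (fun q => hdom _ _ _ _) (by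
      filter_upwards [hset.ae_ne] with q hq
      filter_upwards [hset.ae_finiteEnergy q.2.1, hset.ae_finiteEnergy q.2.2,
        hset.ae_finiteEnergy q.1.1, hset.ae_finiteEnergy q.1.2] with γ h1 h2 h3 h4
      refine ⟨papangelou_mul_offDiag hset.pp hf h1 h2 h3 h4 hq.1 hq.2.1 hq.2.2, ?_⟩
      rw [offDiagExp_eq h1 h2 h3 h4, Real.abs_exp]
      exact exp_le_expDom hf h1 h2 h3 h4 hset.sub_one_mem hset.sub_one_mem
        hset.sub_one_mem hset.sub_one_mem (by norm_num))
  have h4 := integrable_integral_and_integral_prod h1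
  have h5 : (fun p : Config d × (EucSp d × EucSp d) => ∫ y : EucSp d × EucSp d,
      papangelou z φ p.1 p.2.1 * (papangelou z φ (p.1.ins p.2.1) p.2.2 *
        birth s (aScaled a ε) φ f (p.1.ins p.2.1) p.2.2 y.2 *
        birth s (aScaled a ε) φ f (p.1.ins p.2.2) p.2.1 y.1) ∂(volume.prod volume))
      = fun p => papangelou z φ p.1 p.2.1 *
        offDiagMecke z φ (totalBirth s (aScaled a ε) φ f) ((p.1, p.2.1), p.2.2) := by
    ext p
    rw [integral_const_mul]
    congr 1
    have : ∀ y : EucSp d × EucSp d, papangelou z φ (p.1.ins p.2.1) p.2.2 *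
        birth s (aScaled a ε) φ f (p.1.ins p.2.1) p.2.2 y.2 *
        birth s (aScaled a ε) φ f (p.1.ins p.2.2) p.2.1 y.1
        = papangelou z φ (p.1.ins p.2.1) p.2.2 *
          (birth s (aScaled a ε) φ f (p.1.ins p.2.2) p.2.1 y.1 *
          birth s (aScaled a ε) φ f (p.1.ins p.2.1) p.2.2 y.2) := fun y => by ring
    simp_rw [this]
    rw [integral_const_mul, integral_prod_mul, offDiagMecke, totalBirth, totalBirth]
    ring
  have hp := measurePreserving_prodAssoc μ (volume : Measure (EucSp d))
    (volume : Measure (EucSp d))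
  dsimp only at h4
  rw [h5] at h4
  refine ⟨hp.integrable_comp_of_integrable h4.1, h2, ?_⟩
  rw [← h3, ← h4.2, ← hp.integral_comp']
  rfl

end SecondMoment

section Rescaling

variable {d : ℕ} {s z B ξ ε : ℝ} {φ : EucSp d → EReal} {μ : Measure (Config d)}
  {k u : ∀ n : ℕ, (Fin n → EucSp d) → ℝ} {f a : EucSp d → ℝ}

theorem Setting.integral_diag_eq (hset : Setting d s z B ξ φ μ k u) (ha : GoodA a) (hε : 0 < ε)
    (hf : IsC0 f) :
    ∫ q : EucSp d × (EucSp d × EucSp d), z * (jump a ε f q.1 q.2.1 * jump a ε f q.1 q.2.2) *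
        ∫ γ, diagExp s φ f q.1 q.2.1 q.2.2 γ ∂μ ∂(volume.prod (volume.prod volume))
      = ∫ x : EucSp d, ∫ y₁ : EucSp d, ∫ y₂ : EucSp d,
        z * (Real.exp (f x) - 1) * (Real.exp (f (x + ε⁻¹ • (y₂ - y₁))) - 1) * a y₁ * a y₂ *
          ∫ γ, diagExp s φ f (x - ε⁻¹ • y₁) x (x + ε⁻¹ • (y₂ - y₁)) γ ∂μ := by
  rw [integral_prod_prod_eq_integral₃ (hset.integrable_papangelou_mul_totalBirth_sq ha hε hf).2.1]
  refine integral_congr_ae (Eventually.of_forall fun v => ?_)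
  dsimp only
  rw [integral_eq_mul_integral_sub_smul hε _ v, ← integral_const_mul]
  refine integral_congr_ae (Eventually.of_forall fun y₁ => ?_)
  dsimp only
  rw [integral_eq_mul_integral_add_smul hε _ (v - ε⁻¹ • y₁), ← integral_const_mul,
    ← integral_const_mul]
  refine integral_congr_ae (Eventually.of_forall fun y₂ => ?_)
  have h1 : v - ε⁻¹ • y₁ + ε⁻¹ • y₂ = v + ε⁻¹ • (y₂ - y₁) := by
    rw [smul_sub]
    abel
  have h2 : v - ε⁻¹ • y₁ - v = -(ε⁻¹ • y₁) := by abel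
  have h3 : v - ε⁻¹ • y₁ - (v + ε⁻¹ • (y₂ - y₁)) = -(ε⁻¹ • y₂) := by
    rw [smul_sub]
    abel
  have h4 : ε⁻¹ ^ d * ε ^ d = 1 := by rw [← mul_pow, inv_mul_cancel₀ hε.ne', one_pow]
  dsimp only
  rw [h1, jump, jump, h2, h3, ha.aScaled_neg_smul hε, ha.aScaled_neg_smul hε]
  generalize ∫ γ, diagExp s φ f (v - ε⁻¹ • y₁) v (v + ε⁻¹ • (y₂ - y₁)) γ ∂μ = I
  linear_combination (ε⁻¹ ^ d * ε ^ d + 1) * (z * (Real.exp (f v) - 1) *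
    (Real.exp (f (v + ε⁻¹ • (y₂ - y₁))) - 1) * a y₁ * a y₂ * I) * h4

theorem Setting.integral_offDiag_eq (hset : Setting d s z B ξ φ μ k u) (ha : GoodA a)
    (hε : 0 < ε) (hf : IsC0 f) :
    ∫ q : (EucSp d × EucSp d) × (EucSp d × EucSp d),
        z * z * (jump a ε f q.1.1 q.2.1 * jump a ε f q.1.2 q.2.2) *
          (Real.exp (f q.1.1) * Real.exp (f q.1.2) * pairExp s φ q.2.1 q.2.2 q.1.1 q.1.2) *
          ∫ γ, offDiagExp s φ f q.2.1 q.2.2 q.1.1 q.1.2 γ ∂μ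
          ∂((volume.prod volume).prod (volume.prod volume))
      = ∫ x₁ : EucSp d, ∫ x₂ : EucSp d, ∫ y₁ : EucSp d, ∫ y₂ : EucSp d,
        z * z * Real.exp (f (ε⁻¹ • x₁ + y₁)) * Real.exp (f (ε⁻¹ • x₂ + y₂)) *
          (Real.exp (f y₁) - 1) * (Real.exp (f y₂) - 1) * a x₁ * a x₂ *
          pairExp s φ y₁ y₂ (ε⁻¹ • x₁ + y₁) (ε⁻¹ • x₂ + y₂) *
          ∫ γ, offDiagExp s φ f y₁ y₂ (ε⁻¹ • x₁ + y₁) (ε⁻¹ • x₂ + y₂) γ ∂μ := by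
  have hV := (hset.integrable_papangelou_mul_offDiagMecke ha hε hf).2.1
  have hp := measurePreserving_shiftPair (d := d) hε
  have hV' := hp.integrable_comp_of_integrable hV
  rw [← hp.map_eq] at hV ⊢
  rw [integral_map hp.aemeasurable hV.aestronglyMeasurable]
  refine (integral_prod_prod_eq_integral₄ hV').trans ?_
  have h4 : ε⁻¹ ^ d * ε ^ d = 1 := by rw [← mul_pow, inv_mul_cancel₀ hε.ne', one_pow]
  have h5 : (ENNReal.ofReal (ε⁻¹ ^ d)).toReal = ε⁻¹ ^ d := ENNReal.toReal_ofReal (by positivity)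
  rw [integral_smul_measure, h5, smul_eq_mul, ← integral_const_mul]
  refine integral_congr_ae (Eventually.of_forall fun x₁ => ?_)
  dsimp only
  rw [integral_smul_measure, h5, smul_eq_mul, ← integral_const_mul, ← integral_const_mul]
  refine integral_congr_ae (Eventually.of_forall fun x₂ => ?_)
  dsimp only
  rw [← integral_const_mul, ← integral_const_mul]
  refine integral_congr_ae (Eventually.of_forall fun y₁ => ?_)
  dsimp only
  rw [← integral_const_mul, ← integral_const_mul]
  refine integral_congr_ae (Eventually.of_forall fun y₂ => ?_)
  simp only [shiftPair, Function.comp_apply, jump, add_sub_cancel_right, aScaled_smul hε]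
  generalize ∫ γ, offDiagExp s φ f y₁ y₂ (ε⁻¹ • x₁ + y₁) (ε⁻¹ • x₂ + y₂) γ ∂μ = I
  linear_combination (ε⁻¹ ^ d * ε ^ d + 1) *
    (z * z * Real.exp (f (ε⁻¹ • x₁ + y₁)) * Real.exp (f (ε⁻¹ • x₂ + y₂)) *
      (Real.exp (f y₁) - 1) * (Real.exp (f y₂) - 1) * a x₁ * a x₂ *
      pairExp s φ y₁ y₂ (ε⁻¹ • x₁ + y₁) (ε⁻¹ • x₂ + y₂) * I) * h4

end Rescaling

/-- explicit formula for `∫_Γ (H_ε^+ F)² dμ` with `F = e^{⟨f,·⟩}`, `ε > 0`. -/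
theorem statement16 (d : ℕ) (s z B ξ : ℝ) (φ : EucSp d → EReal) (μ : Measure (Config d))
    (k u : ∀ n : ℕ, (Fin n → EucSp d) → ℝ) (hset : Setting d s z B ξ φ μ k u)
    (a : EucSp d → ℝ) (ha : GoodA a)
    (f : EucSp d → ℝ) (hf : IsC0 f) (ε : ℝ) (hε : 0 < ε) :
    ∫ γ, (HepsPlus s (aScaled a ε) φ (fun γ' => Real.exp (cpair f γ')) γ) ^ 2 ∂μ
      = (∫ x : EucSp d, ∫ y₁ : EucSp d, ∫ y₂ : EucSp d,
            z * (Real.exp (f x) - 1) *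
              (Real.exp (f (x + ε⁻¹ • (y₂ - y₁))) - 1) * a y₁ * a y₂ *
            ∫ γ, rexp (((2 * s - 1 : ℝ) : EReal) * energy φ (x - ε⁻¹ • y₁) γ.1 +
              ((s - 1 : ℝ) : EReal) * energy φ x γ.1 +
              ((s - 1 : ℝ) : EReal) * energy φ (x + ε⁻¹ • (y₂ - y₁)) γ.1 +
              ((2 * cpair f γ : ℝ) : EReal)) ∂μ)
        + ∫ x₁ : EucSp d, ∫ x₂ : EucSp d, ∫ y₁ : EucSp d, ∫ y₂ : EucSp d,
            z * z * Real.exp (f (ε⁻¹ • x₁ + y₁)) * Real.exp (f (ε⁻¹ • x₂ + y₂)) *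
              (Real.exp (f y₁) - 1) * (Real.exp (f y₂) - 1) * a x₁ * a x₂ *
              rexp (((2 * s - 1 : ℝ) : EReal) * φ (ε⁻¹ • (x₁ - x₂) + y₁ - y₂) +
                ((s - 1 : ℝ) : EReal) * φ (ε⁻¹ • x₁ + y₁ - y₂) +
                ((s - 1 : ℝ) : EReal) * φ (y₁ - y₂ - ε⁻¹ • x₂)) *
            ∫ γ, rexp (((s - 1 : ℝ) : EReal) * energy φ y₁ γ.1 +
              ((s - 1 : ℝ) : EReal) * energy φ y₂ γ.1 +
              ((s - 1 : ℝ) : EReal) * energy φ (ε⁻¹ • x₁ + y₁) γ.1 +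
              ((s - 1 : ℝ) : EReal) * energy φ (ε⁻¹ • x₂ + y₂) γ.1 +
              ((2 * cpair f γ : ℝ) : EReal)) ∂μ := by
  have := hset.prob
  have := hset.nullSingletonClass
  obtain ⟨h1, -, h2⟩ := hset.integrable_papangelou_mul_totalBirth_sq ha hε hf
  obtain ⟨h3, -, h4⟩ := hset.integrable_papangelou_mul_offDiagMecke ha hε hf
  have hG := measurable_totalBirth (s := s) (ha.measurable_aScaled (ε := ε)) hset.pp.meas
    hf.1.measurable
  have h5 := integral_sq_tsum_del hset.hz.le hset.pp.meas hset.gnz hG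
    (hset.integrable_papangelou_mul_totalBirth ha hε hf) h1 h3
  rw [h2, h4, hset.integral_diag_eq ha hε hf, hset.integral_offDiag_eq ha hε hf] at h5
  simp_rw [HepsPlus_eq_tsum_birth, neg_sq]
  refine h5.trans (congrArg₂ _ rfl ?_)
  refine integral_congr_ae (Eventually.of_forall fun x₁ => ?_)
  refine integral_congr_ae (Eventually.of_forall fun x₂ => ?_)
  refine integral_congr_ae (Eventually.of_forall fun y₁ => ?_)
  refine integral_congr_ae (Eventually.of_forall fun y₂ => ?_)
  have e1 : ε⁻¹ • x₁ + y₁ - (ε⁻¹ • x₂ + y₂) = ε⁻¹ • (x₁ - x₂) + y₁ - y₂ := by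
    rw [smul_sub]
    abel
  have e2 : y₁ - (ε⁻¹ • x₂ + y₂) = y₁ - y₂ - ε⁻¹ • x₂ := by abel
  simp only [pairExp, offDiagExp, e1, e2]

end
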